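/- arXiv:1706.02394 — 2 statements merged into one kernel-verified Lean document; each statement's English description precedes it below -/
import Mathlib

section
/- Under the holonomic system hypotheses with the conformally flat constant-mean-curvature ansatz, define α1 := (1/v2) ∂v2/∂u1, α2 := (1/v3) ∂v3/∂u2, α3 := (1/v1) ∂v1/∂u3, and set F := (1/(27 v1 v2 v3)) [9 v1^2 v3^8 (v2^2 + v3^2) α1^2 + 9 v1^8 v2^2 (v1^2 - v3^2) α2^2 - 9 v2^8 v3^2 (v1^2 + v2^2) α3^2 - v1^2 v2^2 v3^2 (2 v1^2 v2^4 - 2 v1^2 v3^4 - 2 v2^2 v3^4 - v1^2 v2^2 v3^2)], m1 := (v2^2 + 4 v3^2)(4 v2^2 + v3^2) - 8 v1 v2 v3 (v2^2 + v3^2) H, m2 := (v1^2 - 4 v3^2)(4 v1^2 - v3^2) - 8 v1 v2 v3 (v1^2 - v3^2) H, m3 := (v1^2 + 4 v2^2)(4 v1^2 + v2^2) + 8 v1 v2 v3 (v1^2 + v2^2) H. Then the following three algebraic relations hold identically on U: ((30 v1/(v2 v3^9)) F - (4 v1^4 v2^2 / v3^6)(v1^2 - v3^2) c + (v1^3 v2/(18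 v3^7)) m2 H) α2 = 0; ((30 v2/(v1^9 v3)) F + (4 v2^4 v3^2 / v1^6)(v1^2 + v2^2) c + (v3 v2^3/(18 v1^7)) m3 H) α3 = 0; ((30 v3/(v1 v2^9)) F - (4 v1^2 v3^4 / v2^6)(v2^2 + v3^2) c + (v1 v3^3/(18 v2^7)) m1 H) α1 = 0. -/
noncomputable section

/-- Partial derivative of `f : ℝ³ → ℝ` in the `i`-th coordinate direction `u_{i+1}`. -/
noncomputable def pd (i : Fin 3) (f : (Fin 3 → ℝ) → ℝ) (p : Fin 3 → ℝ) : ℝ :=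
  fderiv ℝ f p (Pi.single i 1)

/-- `hh v i j p = h_{ij}(p) = (1/v_i) ∂v_j/∂u_i` (indices shifted down by one:
`v 0, v 1, v 2` are `v₁, v₂, v₃` and directions `0,1,2` are `u₁,u₂,u₃`). -/
noncomputable def hh (v : Fin 3 → (Fin 3 → ℝ) → ℝ) (i j : Fin 3) (p : Fin 3 → ℝ) : ℝ :=
  (1 / v i p) * pd i (v j) p

/-- `al v 0 = α₁ = (1/v₂)∂v₂/∂u₁`, `al v 1 = α₂ = (1/v₃)∂v₃/∂u₂`,
`al v 2 = α₃ = (1/v₁)∂v₁/∂u₃`. -/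
noncomputable def al (v : Fin 3 → (Fin 3 → ℝ) → ℝ) (i : Fin 3) (p : Fin 3 → ℝ) : ℝ :=
  (1 / v (i + 1) p) * pd i (v (i + 1)) p

/-- The holonomic system hypotheses together with the conformally flat
constant-mean-curvature ansatz, on a connected open set `U ⊆ ℝ³`. -/
structure Hypo (U : Set (Fin 3 → ℝ)) (v V : Fin 3 → (Fin 3 → ℝ) → ℝ) (c H : ℝ) : Prop where
  hopen : IsOpen U
  hconn : IsConnected U
  smooth_v : ∀ i, ContDiffOn ℝ (⊤ : ℕ∞) (v i) U
  smooth_V : ∀ i, ContDiffOn ℝ (⊤ : ℕ∞) (V i) U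
  pos : ∀ i, ∀ p ∈ U, 0 < v i p
  holi : ∀ i j, i ≠ j → ∀ p ∈ U, pd j (v i) p = hh v j i p * v j p
  holii : ∀ i j k, i ≠ j → j ≠ k → i ≠ k → ∀ p ∈ U,
    pd j (hh v i k) p = hh v i j p * hh v j k p
  holiii : ∀ i j k, i ≠ j → j ≠ k → i ≠ k → ∀ p ∈ U,
    pd i (hh v i j) p + pd j (hh v j i) p + hh v k i p * hh v k j p
      + V i p * V j p + c * v i p * v j p = 0
  holiv : ∀ i j, i ≠ j → ∀ p ∈ U, pd j (V i) p = hh v j i p * V j p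
  ansatz_v : ∀ p ∈ U, (v 1 p) ^ 2 = (v 0 p) ^ 2 + (v 2 p) ^ 2
  ansatz_V1 : ∀ p ∈ U, V 0 p = -(1/3) * (v 1 p / v 2 p + v 2 p / v 1 p) + (v 0 p / 3) * H
  ansatz_V2 : ∀ p ∈ U, V 1 p = -(1/3) * (v 0 p / v 2 p - v 2 p / v 0 p) + (v 1 p / 3) * H
  ansatz_V3 : ∀ p ∈ U, V 2 p = (1/3) * (v 0 p / v 1 p + v 1 p / v 0 p) + (v 2 p / 3) * H

/-- The function `F` of Proposition 2.1. -/
noncomputable def Fexpr (v : Fin 3 → (Fin 3 → ℝ) → ℝ) (p : Fin 3 → ℝ) : ℝ :=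
  (1 / (27 * v 0 p * v 1 p * v 2 p)) *
    (9 * (v 0 p) ^ 2 * (v 2 p) ^ 8 * ((v 1 p) ^ 2 + (v 2 p) ^ 2) * (al v 0 p) ^ 2
      + 9 * (v 0 p) ^ 8 * (v 1 p) ^ 2 * ((v 0 p) ^ 2 - (v 2 p) ^ 2) * (al v 1 p) ^ 2
      - 9 * (v 1 p) ^ 8 * (v 2 p) ^ 2 * ((v 0 p) ^ 2 + (v 1 p) ^ 2) * (al v 2 p) ^ 2
      - (v 0 p) ^ 2 * (v 1 p) ^ 2 * (v 2 p) ^ 2 *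
        (2 * (v 0 p) ^ 2 * (v 1 p) ^ 4 - 2 * (v 0 p) ^ 2 * (v 2 p) ^ 4
          - 2 * (v 1 p) ^ 2 * (v 2 p) ^ 4 - (v 0 p) ^ 2 * (v 1 p) ^ 2 * (v 2 p) ^ 2))

/-- `m₁` of Proposition 2.1. -/
noncomputable def m1expr (v : Fin 3 → (Fin 3 → ℝ) → ℝ) (H : ℝ) (p : Fin 3 → ℝ) : ℝ :=
  ((v 1 p) ^ 2 + 4 * (v 2 p) ^ 2) * (4 * (v 1 p) ^ 2 + (v 2 p) ^ 2)
    - 8 * v 0 p * v 1 p * v 2 p * ((v 1 p) ^ 2 + (v 2 p) ^ 2) * H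

/-- `m₂` of Proposition 2.1. -/
noncomputable def m2expr (v : Fin 3 → (Fin 3 → ℝ) → ℝ) (H : ℝ) (p : Fin 3 → ℝ) : ℝ :=
  ((v 0 p) ^ 2 - 4 * (v 2 p) ^ 2) * (4 * (v 0 p) ^ 2 - (v 2 p) ^ 2)
    - 8 * v 0 p * v 1 p * v 2 p * ((v 0 p) ^ 2 - (v 2 p) ^ 2) * H

/-- `m₃` of Proposition 2.1. -/
noncomputable def m3expr (v : Fin 3 → (Fin 3 → ℝ) → ℝ) (H : ℝ) (p : Fin 3 → ℝ) : ℝ :=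
  ((v 0 p) ^ 2 + 4 * (v 1 p) ^ 2) * (4 * (v 0 p) ^ 2 + (v 1 p) ^ 2)
    + 8 * v 0 p * v 1 p * v 2 p * ((v 0 p) ^ 2 + (v 1 p) ^ 2) * H

section PartialDerivatives

variable {f g : (Fin 3 → ℝ) → ℝ} {p : Fin 3 → ℝ} {U : Set (Fin 3 → ℝ)}

theorem pd_const (i : Fin 3) (r : ℝ) : pd i (fun _ => r) p = 0 := by
  simp [pd]

theorem pd_neg (i : Fin 3) : pd i (fun q => -f q) p = -pd i f p := by
  simp [pd, fderiv_fun_neg]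

theorem pd_add (i : Fin 3) (hf : DifferentiableAt ℝ f p) (hg : DifferentiableAt ℝ g p) :
    pd i (fun q => f q + g q) p = pd i f p + pd i g p := by
  simp [pd, fderiv_fun_add hf hg]

theorem pd_sub (i : Fin 3) (hf : DifferentiableAt ℝ f p) (hg : DifferentiableAt ℝ g p) :
    pd i (fun q => f q - g q) p = pd i f p - pd i g p := by
  simp [pd, fderiv_fun_sub hf hg]

theorem pd_mul (i : Fin 3) (hf : DifferentiableAt ℝ f p) (hg : DifferentiableAt ℝ g p) :
    pd i (fun q => f q * g q) p = pd i f p * g p + f p * pd i g p := by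
  simp [pd, fderiv_fun_mul hf hg]
  ring

theorem pd_pow (i : Fin 3) (n : ℕ) (hf : DifferentiableAt ℝ f p) :
    pd i (fun q => f q ^ n) p = n * f p ^ (n - 1) * pd i f p := by
  simp [pd, fderiv_fun_pow n hf]

theorem pd_div (i : Fin 3) (hf : DifferentiableAt ℝ f p) (hg : DifferentiableAt ℝ g p)
    (h0 : g p ≠ 0) :
    pd i (fun q => f q / g q) p = (pd i f p * g p - f p * pd i g p) / g p ^ 2 := by
  have h := hf.hasFDerivAt.mul ((hasDerivAt_inv h0).comp_hasFDerivAt p hg.hasFDerivAt)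
  have he : (fun q => f q / g q) = f * (Inv.inv ∘ g) := by
    funext q
    simp [div_eq_mul_inv]
  unfold pd
  rw [he, h.fderiv]
  simp
  field_simp
  ring

theorem pd_congr (hU : IsOpen U) (h : Set.EqOn f g U) (hp : p ∈ U) (i : Fin 3) :
    pd i f p = pd i g p := by
  unfold pd
  rw [Filter.EventuallyEq.fderiv_eq (h.eventuallyEq_of_mem (hU.mem_nhds hp))]

theorem contDiffOn_pd (hU : IsOpen U) (hf : ContDiffOn ℝ (⊤ : ℕ∞) f U) (i : Fin 3) :
    ContDiffOn ℝ (⊤ : ℕ∞) (pd i f) U :=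
  (hf.fderiv_of_isOpen hU (m := (⊤ : ℕ∞)) (by simp)).clm_apply contDiffOn_const

theorem ContDiffOn.differentiableAt_of_isOpen (hU : IsOpen U)
    (hf : ContDiffOn ℝ (⊤ : ℕ∞) f U) (hp : p ∈ U) : DifferentiableAt ℝ f p :=
  (hf.contDiffAt (hU.mem_nhds hp)).differentiableAt (by simp)

theorem pd_comm (hU : IsOpen U) (hf : ContDiffOn ℝ (⊤ : ℕ∞) f U) (hp : p ∈ U) (i j : Fin 3) :
    pd i (pd j f) p = pd j (pd i f) p := by
  have hf2 : ContDiffAt ℝ (⊤ : ℕ∞) f p := hf.contDiffAt (hU.mem_nhds hp)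
  have hsym : IsSymmSndFDerivAt ℝ f p :=
    hf2.isSymmSndFDerivAt (by
      simpa [minSmoothness] using WithTop.coe_le_coe.2 (le_top : (2 : ℕ∞) ≤ ⊤))
  have hd : DifferentiableAt ℝ (fderiv ℝ f) p :=
    (hf2.fderiv_right (m := 1) (WithTop.coe_le_coe.2
      (le_top : (2 : ℕ∞) ≤ ⊤))).differentiableAt (by simp)
  have key : ∀ k l : Fin 3, pd k (pd l f) p
      = fderiv ℝ (fderiv ℝ f) p (Pi.single k 1) (Pi.single l 1) := by
    intro k l
    unfold pd
    rw [fderiv_clm_apply hd (by fun_prop)]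
    simp
  rw [key, key]
  exact hsym _ _

theorem pd_eq_zero_of_mul_eq_zero (hU : IsOpen U) (hf : ContDiffOn ℝ (⊤ : ℕ∞) f U)
    (hg : ContDiffOn ℝ (⊤ : ℕ∞) g U) (hfg : ∀ q ∈ U, f q * g q = 0) (hp : p ∈ U)
    (h0 : f p ≠ 0) (i : Fin 3) : pd i g p = 0 := by
  have df := ContDiffOn.differentiableAt_of_isOpen hU hf hp
  have dg := ContDiffOn.differentiableAt_of_isOpen hU hg hp
  have hc := pd_congr (g := fun _ => 0) hU hfg hp i
  rw [pd_mul i df dg, pd_const, (mul_eq_zero.1 (hfg p hp)).resolve_left h0, mul_zero,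
    zero_add] at hc
  exact (mul_eq_zero.1 hc).resolve_left h0

end PartialDerivatives

/-- The first order system satisfied by `x = v₁`, `y = v₂`, `z = v₃` and the logarithmic
derivatives `a = α₁`, `b = α₂`, `e = α₃`, where `K = c + H² / 9`. Even powers of `y` are
eliminated through `y² = x² + z²`. -/
structure ReducedSystem (U : Set (Fin 3 → ℝ)) (x y z a b e : (Fin 3 → ℝ) → ℝ) (K H : ℝ) :
    Prop where
  isOpen : IsOpen U
  contDiffOn_x : ContDiffOn ℝ (⊤ : ℕ∞) x U
  contDiffOn_y : ContDiffOn ℝ (⊤ : ℕ∞) y U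
  contDiffOn_z : ContDiffOn ℝ (⊤ : ℕ∞) z U
  contDiffOn_a : ContDiffOn ℝ (⊤ : ℕ∞) a U
  contDiffOn_b : ContDiffOn ℝ (⊤ : ℕ∞) b U
  contDiffOn_e : ContDiffOn ℝ (⊤ : ℕ∞) e U
  x_pos : ∀ q ∈ U, 0 < x q
  y_pos : ∀ q ∈ U, 0 < y q
  z_pos : ∀ q ∈ U, 0 < z q
  sq_eq : ∀ q ∈ U, y q ^ 2 = x q ^ 2 + z q ^ 2
  pd_x0 : ∀ q ∈ U, pd 0 x q =
        a q * x q * (x q ^ 4 + 3 * x q ^ 2 * z q ^ 2 + 3 * z q ^ 4) / ((x q ^ 2 + z q ^ 2) ^ 2)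
  pd_x1 : ∀ q ∈ U, pd 1 x q =
        b q * x q ^ 5 / (z q ^ 4)
  pd_x2 : ∀ q ∈ U, pd 2 x q =
        e q * x q
  pd_y0 : ∀ q ∈ U, pd 0 y q =
        a q * y q
  pd_y1 : ∀ q ∈ U, pd 1 y q =
        b q * y q * (x q ^ 4 - x q ^ 2 * z q ^ 2 + z q ^ 4) / (z q ^ 4)
  pd_y2 : ∀ q ∈ U, pd 2 y q =
        e q * y q * (x q ^ 2 + z q ^ 2) ^ 2 / (x q ^ 4)
  pd_z0 : ∀ q ∈ U, pd 0 z q =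
        a q * z q ^ 5 / ((x q ^ 2 + z q ^ 2) ^ 2)
  pd_z1 : ∀ q ∈ U, pd 1 z q =
        b q * z q
  pd_z2 : ∀ q ∈ U, pd 2 z q =
        e q * z q * (3 * x q ^ 4 + 3 * x q ^ 2 * z q ^ 2 + z q ^ 4) / (x q ^ 4)
  pd_a0 : ∀ q ∈ U, pd 0 a q =
        H * y q * x q * (x q ^ 2 + 2 * z q ^ 2) / (18 * z q ^ 3)
        + a q ^ 2 * (3 * x q ^ 4 + 6 * x q ^ 2 * z q ^ 2 + 2 * z q ^ 4) / ((x q ^ 2 + z q ^ 2) ^ 2)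
        + b q ^ 2 * x q ^ 6 * (-3 * x q ^ 2 + 2 * z q ^ 2) / (z q ^ 8)
        + e q ^ 2 * (x q ^ 2 + z q ^ 2) ^ 2 * (5 * x q ^ 2 + 2 * z q ^ 2) / (x q ^ 2 * z q ^ 4)
        + K * x q ^ 2 * (x q ^ 2 + z q ^ 2) * (-1) / (z q ^ 2)
        + (5 * x q ^ 4 + 2 * x q ^ 2 * z q ^ 2 + 2 * z q ^ 4) / (9 * z q ^ 4)
  pd_a1 : ∀ q ∈ U, pd 1 a q =
        2 * a q * b q * x q ^ 2 * (3 * x q ^ 2 - z q ^ 2) / (z q ^ 4)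
  pd_a2 : ∀ q ∈ U, pd 2 a q =
        2 * a q * e q * z q ^ 2 * (-1) / (x q ^ 2)
  pd_b0 : ∀ q ∈ U, pd 0 b q =
        2 * a q * b q * x q ^ 2 / ((x q ^ 2 + z q ^ 2))
  pd_b1 : ∀ q ∈ U, pd 1 b q =
        H * y q * z q * (-x q ^ 2 + z q ^ 2) / (18 * x q ^ 3)
        + a q ^ 2 * z q ^ 4 * (-3 * x q ^ 2 - 5 * z q ^ 2) / (x q ^ 4 * (x q ^ 2 + z q ^ 2))
        + b q ^ 2 * (-x q ^ 4 + 3 * z q ^ 4) / (z q ^ 4)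
        + e q ^ 2 * (x q ^ 2 + z q ^ 2) ^ 3 * (-5 * x q ^ 2 - 3 * z q ^ 2) / (x q ^ 8)
        + K * z q ^ 2 * (x q ^ 2 + z q ^ 2) / (x q ^ 2)
        + (-5 * x q ^ 4 - 8 * x q ^ 2 * z q ^ 2 - 5 * z q ^ 4) / (9 * x q ^ 4)
  pd_b2 : ∀ q ∈ U, pd 2 b q =
        2 * b q * e q * (x q ^ 2 + z q ^ 2) * (4 * x q ^ 2 + 3 * z q ^ 2) / (x q ^ 4)
  pd_e0 : ∀ q ∈ U, pd 0 e q =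
        2 * a q * e q * z q ^ 2 * (x q ^ 2 + 4 * z q ^ 2) / ((x q ^ 2 + z q ^ 2) ^ 2)
  pd_e1 : ∀ q ∈ U, pd 1 e q =
        2 * b q * e q * (x q ^ 2 + z q ^ 2) / (z q ^ 2)
  pd_e2 : ∀ q ∈ U, pd 2 e q =
        H * y q * x q * z q * (-2 * x q ^ 2 - z q ^ 2) / (18 * (x q ^ 2 + z q ^ 2) ^ 2)
        + a q ^ 2 * z q ^ 6 * (2 * x q ^ 2 + 5 * z q ^ 2) / ((x q ^ 2 + z q ^ 2) ^ 4)
        + b q ^ 2 * x q ^ 4 * (2 * x q ^ 2 - 3 * z q ^ 2) / (z q ^ 2 * (x q ^ 2 + z q ^ 2) ^ 2)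
        + e q ^ 2 * (2 * x q ^ 4 - 2 * x q ^ 2 * z q ^ 2 - z q ^ 4) / (x q ^ 4)
        + K * x q ^ 2 * z q ^ 2 * (-1) / ((x q ^ 2 + z q ^ 2))
        + (2 * x q ^ 4 + 2 * x q ^ 2 * z q ^ 2 + 5 * z q ^ 4) / (9 * (x q ^ 2 + z q ^ 2) ^ 2)

namespace ReducedSystem

variable {U : Set (Fin 3 → ℝ)} {x y z a b e : (Fin 3 → ℝ) → ℝ} {K H : ℝ} {p : Fin 3 → ℝ}

theorem contDiffOn_xyz (h : ReducedSystem U x y z a b e K H) :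
    ContDiffOn ℝ (⊤ : ℕ∞) x U ∧ ContDiffOn ℝ (⊤ : ℕ∞) y U ∧ ContDiffOn ℝ (⊤ : ℕ∞) z U :=
  ⟨h.contDiffOn_x, h.contDiffOn_y, h.contDiffOn_z⟩

theorem differentiableAt_xyz (h : ReducedSystem U x y z a b e K H) (hp : p ∈ U) :
    DifferentiableAt ℝ x p ∧ DifferentiableAt ℝ y p ∧ DifferentiableAt ℝ z p :=
  ⟨h.contDiffOn_x.differentiableAt_of_isOpen h.isOpen hp,
    h.contDiffOn_y.differentiableAt_of_isOpen h.isOpen hp,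
    h.contDiffOn_z.differentiableAt_of_isOpen h.isOpen hp⟩

theorem differentiableAt_abe (h : ReducedSystem U x y z a b e K H) (hp : p ∈ U) :
    DifferentiableAt ℝ a p ∧ DifferentiableAt ℝ b p ∧ DifferentiableAt ℝ e p :=
  ⟨h.contDiffOn_a.differentiableAt_of_isOpen h.isOpen hp,
    h.contDiffOn_b.differentiableAt_of_isOpen h.isOpen hp,
    h.contDiffOn_e.differentiableAt_of_isOpen h.isOpen hp⟩

theorem compat_b (h : ReducedSystem U x y z a b e K H) (hp : p ∈ U) :
    b p * (20 * (9 * x p ^ 2 * z p ^ 8 * (x p ^ 2 + 2 * z p ^ 2) * a p ^ 2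
        + 9 * x p ^ 8 * (x p ^ 2 + z p ^ 2) * (x p ^ 2 - z p ^ 2) * b p ^ 2
        - 9 * (x p ^ 2 + z p ^ 2) ^ 4 * z p ^ 2 * (2 * x p ^ 2 + z p ^ 2) * e p ^ 2
        - x p ^ 2 * z p ^ 2 * (x p ^ 2 + z p ^ 2) * (x p ^ 2 - z p ^ 2)
          * (2 * x p ^ 2 + z p ^ 2) * (x p ^ 2 + 2 * z p ^ 2))
      + x p ^ 3 * z p ^ 3 * (x p ^ 2 + z p ^ 2)
        * (72 * x p * z p * (x p ^ 2 + z p ^ 2) * (x p ^ 2 - z p ^ 2) * K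
          - y p * (4 * x p ^ 4 - 17 * x p ^ 2 * z p ^ 2 + 4 * z p ^ 4) * H)) = 0 := by
  have hx := h.x_pos p hp
  have hz := h.z_pos p hp
  obtain ⟨dx, dy, dz⟩ := h.differentiableAt_xyz hp
  obtain ⟨da, db, de⟩ := h.differentiableAt_abe hp
  have hc := pd_comm h.isOpen h.contDiffOn_a hp 0 1
  rw [pd_congr h.isOpen (fun q hq => h.pd_a0 q hq) hp,
    pd_congr h.isOpen (fun q hq => h.pd_a1 q hq) hp] at hc
  simp (disch := first | positivity | fun_prop (disch := positivity)) only [pd_add, pd_mul,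
      pd_pow, pd_div, pd_const, pd_sub, h.pd_x0 p hp, h.pd_x1 p hp, h.pd_y1 p hp, h.pd_z0 p hp,
      h.pd_z1 p hp, h.pd_a0 p hp, h.pd_a1 p hp, h.pd_b0 p hp, h.pd_b1 p hp, h.pd_e1 p hp,
      Nat.cast_ofNat, Nat.reduceSub, pow_one, zero_mul, mul_zero, zero_add, add_zero] at hc
  linear_combination (norm := (field_simp; ring))
    18 * z p ^ 10 * (x p ^ 2 + z p ^ 2) * hc

theorem compat_a (h : ReducedSystem U x y z a b e K H) (hp : p ∈ U) :
    a p * (20 * (9 * x p ^ 2 * z p ^ 8 * (x p ^ 2 + 2 * z p ^ 2) * a p ^ 2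
        + 9 * x p ^ 8 * (x p ^ 2 + z p ^ 2) * (x p ^ 2 - z p ^ 2) * b p ^ 2
        - 9 * (x p ^ 2 + z p ^ 2) ^ 4 * z p ^ 2 * (2 * x p ^ 2 + z p ^ 2) * e p ^ 2
        - x p ^ 2 * z p ^ 2 * (x p ^ 2 + z p ^ 2) * (x p ^ 2 - z p ^ 2)
          * (2 * x p ^ 2 + z p ^ 2) * (x p ^ 2 + 2 * z p ^ 2))
      + x p ^ 3 * z p ^ 3 * (x p ^ 2 + z p ^ 2)
        * (72 * x p * z p * (x p ^ 2 + z p ^ 2) * (x p ^ 2 + 2 * z p ^ 2) * K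
          - y p * (4 * x p ^ 4 + 25 * x p ^ 2 * z p ^ 2 + 25 * z p ^ 4) * H)) = 0 := by
  have hx := h.x_pos p hp
  have hz := h.z_pos p hp
  obtain ⟨dx, dy, dz⟩ := h.differentiableAt_xyz hp
  obtain ⟨da, db, de⟩ := h.differentiableAt_abe hp
  have hc := pd_comm h.isOpen h.contDiffOn_b hp 0 1
  rw [pd_congr h.isOpen (fun q hq => h.pd_b0 q hq) hp,
    pd_congr h.isOpen (fun q hq => h.pd_b1 q hq) hp] at hc
  simp (disch := first | positivity | fun_prop (disch := positivity)) only [pd_add, pd_mul,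
      pd_pow, pd_div, pd_const, pd_sub, pd_neg, h.pd_x0 p hp, h.pd_x1 p hp, h.pd_y0 p hp,
      h.pd_z0 p hp, h.pd_z1 p hp, h.pd_a0 p hp, h.pd_a1 p hp, h.pd_b0 p hp, h.pd_b1 p hp,
      h.pd_e0 p hp, Nat.cast_ofNat, Nat.reduceSub, pow_one, zero_mul, zero_add] at hc
  linear_combination (norm := (field_simp; ring))
    (18 * x p ^ 6 * z p ^ 2 * (x p ^ 2 + z p ^ 2) ^ 2) * hc

theorem compat_e (h : ReducedSystem U x y z a b e K H) (hp : p ∈ U) :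
    e p * (20 * (9 * x p ^ 2 * z p ^ 8 * (x p ^ 2 + 2 * z p ^ 2) * a p ^ 2
        + 9 * x p ^ 8 * (x p ^ 2 + z p ^ 2) * (x p ^ 2 - z p ^ 2) * b p ^ 2
        - 9 * (x p ^ 2 + z p ^ 2) ^ 4 * z p ^ 2 * (2 * x p ^ 2 + z p ^ 2) * e p ^ 2
        - x p ^ 2 * z p ^ 2 * (x p ^ 2 + z p ^ 2) * (x p ^ 2 - z p ^ 2)
          * (2 * x p ^ 2 + z p ^ 2) * (x p ^ 2 + 2 * z p ^ 2))
      + x p ^ 3 * z p ^ 3 * (x p ^ 2 + z p ^ 2)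
        * (72 * x p * z p * (x p ^ 2 + z p ^ 2) * (-(2 * x p ^ 2 + z p ^ 2)) * K
          - y p * (25 * x p ^ 4 + 25 * x p ^ 2 * z p ^ 2 + 4 * z p ^ 4) * H)) = 0 := by
  have hx := h.x_pos p hp
  have hz := h.z_pos p hp
  obtain ⟨dx, dy, dz⟩ := h.differentiableAt_xyz hp
  obtain ⟨da, db, de⟩ := h.differentiableAt_abe hp
  have hc := pd_comm h.isOpen h.contDiffOn_a hp 0 2
  rw [pd_congr h.isOpen (fun q hq => h.pd_a0 q hq) hp,
    pd_congr h.isOpen (fun q hq => h.pd_a2 q hq) hp] at hc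
  simp (disch := first | positivity | fun_prop (disch := positivity)) only [pd_add, pd_mul,
      pd_pow, pd_div, pd_const, h.pd_x0 p hp, h.pd_x2 p hp, h.pd_y2 p hp, h.pd_z0 p hp,
      h.pd_z2 p hp, h.pd_a0 p hp, h.pd_a2 p hp, h.pd_b2 p hp, h.pd_e0 p hp, h.pd_e2 p hp,
      Nat.cast_ofNat, Nat.reduceSub, pow_one, zero_mul, mul_zero, zero_add, add_zero] at hc
  linear_combination (norm := (field_simp; ring))
    (-18 * x p ^ 4 * z p ^ 6 * (x p ^ 2 + z p ^ 2)) * hc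

theorem be_relation (h : ReducedSystem U x y z a b e K H) (hp : p ∈ U) :
    b p * e p * (72 * x p * z p * (x p ^ 2 + z p ^ 2) * K + 7 * y p * (x p ^ 2 + 2 * z p ^ 2) * H)
      = 0 := by
  have hx := h.x_pos p hp
  have hz := h.z_pos p hp
  have h1 := h.compat_b hp
  have h2 := h.compat_e hp
  linear_combination (norm := (field_simp; ring))
    (e p * h1 - b p * h2) / (3 * x p ^ 2 * x p ^ 3 * z p ^ 3 * (x p ^ 2 + z p ^ 2))

theorem eq_zero_of_b_e_ne_zero (h : ReducedSystem U x y z a b e K H) (hp : p ∈ U)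
    (hm : b p ≠ 0) (hn : e p ≠ 0) : H = 0 ∧ K = 0 := by
  have hx := h.x_pos p hp
  have hz := h.z_pos p hp
  obtain ⟨dx, dy, dz⟩ := h.differentiableAt_xyz hp
  have hy := h.y_pos p hp
  have hr : 72 * x p * z p * (x p ^ 2 + z p ^ 2) * K + 7 * y p * (x p ^ 2 + 2 * z p ^ 2) * H = 0 :=
    (mul_eq_zero.1 (h.be_relation hp)).resolve_left (mul_ne_zero hm hn)
  obtain ⟨hx', hy', hz'⟩ := h.contDiffOn_xyz
  have hd := pd_eq_zero_of_mul_eq_zero h.isOpen (h.contDiffOn_b.mul h.contDiffOn_e)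
    (g := fun q => 72 * x q * z q * (x q ^ 2 + z q ^ 2) * K + 7 * y q * (x q ^ 2 + 2 * z q ^ 2) * H)
    (by fun_prop) (fun q hq => h.be_relation hq) hp (mul_ne_zero hm hn) 1
  simp (disch := first | positivity | fun_prop (disch := positivity)) only [pd_add, pd_mul,
      pd_pow, pd_const, h.pd_x1 p hp, h.pd_y1 p hp, h.pd_z1 p hp, Nat.cast_ofNat, Nat.reduceSub,
      pow_one, zero_mul, mul_zero, zero_add, add_zero] at hd
  have key : (-1512 * b p * y p * x p ^ 5 * (x p ^ 2 + z p ^ 2) / z p) * H = 0 := by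
    linear_combination (norm := (field_simp; ring))
      72 * x p * z p * (x p ^ 2 + z p ^ 2) * hd - (72 * b p * x p * (x p ^ 2 + z p ^ 2)
        * (3 * x p ^ 4 - 2 * x p ^ 2 * z p ^ 2 + 3 * z p ^ 4) / (z p ^ 3)) * hr
  have hH : H = 0 := by
    refine (mul_eq_zero.1 key).resolve_left ?_
    have := hx.ne'
    have := hy.ne'
    have := hz.ne'
    have : (x p ^ 2 + z p ^ 2) ≠ 0 := by positivity
    simp [*]
  refine ⟨hH, ?_⟩
  rw [hH, mul_zero, add_zero] at hr
  exact (mul_eq_zero.1 hr).resolve_left (by positivity)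

theorem ab_relation (h : ReducedSystem U x y z a b e K H) (hp : p ∈ U) :
    a p * b p * (72 * x p * z p * (x p ^ 2 + z p ^ 2) * K
      + 7 * y p * (-2 * x p ^ 2 - z p ^ 2) * H) = 0 := by
  have hx := h.x_pos p hp
  have hz := h.z_pos p hp
  have h1 := h.compat_a hp
  have h2 := h.compat_b hp
  linear_combination (norm := (field_simp; ring))
    (b p * h1 - a p * h2) / (3 * z p ^ 2 * x p ^ 3 * z p ^ 3 * (x p ^ 2 + z p ^ 2))

theorem eq_zero_of_a_b_ne_zero (h : ReducedSystem U x y z a b e K H) (hp : p ∈ U)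
    (hm : a p ≠ 0) (hn : b p ≠ 0) : H = 0 ∧ K = 0 := by
  have hx := h.x_pos p hp
  have hz := h.z_pos p hp
  obtain ⟨dx, dy, dz⟩ := h.differentiableAt_xyz hp
  have hy := h.y_pos p hp
  have hr : 72 * x p * z p * (x p ^ 2 + z p ^ 2) * K + 7 * y p * (-2 * x p ^ 2 - z p ^ 2) * H = 0 :=
    (mul_eq_zero.1 (h.ab_relation hp)).resolve_left (mul_ne_zero hm hn)
  obtain ⟨hx', hy', hz'⟩ := h.contDiffOn_xyz
  have hd := pd_eq_zero_of_mul_eq_zero h.isOpen (h.contDiffOn_a.mul h.contDiffOn_b)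
    (g := fun q => 72 * x q * z q * (x q ^ 2 + z q ^ 2) * K
      + 7 * y q * (-2 * x q ^ 2 - z q ^ 2) * H)
    (by fun_prop) (fun q hq => h.ab_relation hq) hp (mul_ne_zero hm hn) 0
  simp (disch := first | positivity | fun_prop (disch := positivity)) only [pd_add, pd_mul,
      pd_pow, pd_const, pd_sub, h.pd_x0 p hp, h.pd_y0 p hp, h.pd_z0 p hp, Nat.cast_ofNat,
      Nat.reduceSub, pow_one, zero_mul, mul_zero, zero_add, add_zero] at hd
  have key : (1512 * a p * y p * x p * z p ^ 5) * H = 0 := by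
    linear_combination (norm := (field_simp; ring))
      72 * x p * z p * (x p ^ 2 + z p ^ 2) * hd - (72 * a p * x p * z p
        * (3 * x p ^ 4 + 7 * x p ^ 2 * z p ^ 2 + 6 * z p ^ 4) / (x p ^ 2 + z p ^ 2)) * hr
  have hH : H = 0 := by
    refine (mul_eq_zero.1 key).resolve_left ?_
    have := hx.ne'
    have := hy.ne'
    have := hz.ne'
    have : (x p ^ 2 + z p ^ 2) ≠ 0 := by positivity
    simp [*]
  refine ⟨hH, ?_⟩
  rw [hH, mul_zero, add_zero] at hr
  exact (mul_eq_zero.1 hr).resolve_left (by positivity)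

theorem ae_relation (h : ReducedSystem U x y z a b e K H) (hp : p ∈ U) :
    a p * e p * (72 * x p * z p * (x p ^ 2 + z p ^ 2) * K + 7 * y p * (x p ^ 2 - z p ^ 2) * H)
      = 0 := by
  have hx := h.x_pos p hp
  have hz := h.z_pos p hp
  have h1 := h.compat_a hp
  have h2 := h.compat_e hp
  linear_combination (norm := (field_simp; ring))
    (e p * h1 - a p * h2) / (3 * (x p ^ 2 + z p ^ 2) * x p ^ 3 * z p ^ 3 * (x p ^ 2 + z p ^ 2))

theorem eq_zero_of_a_e_ne_zero (h : ReducedSystem U x y z a b e K H) (hp : p ∈ U)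
    (hm : a p ≠ 0) (hn : e p ≠ 0) : H = 0 ∧ K = 0 := by
  have hx := h.x_pos p hp
  have hz := h.z_pos p hp
  obtain ⟨dx, dy, dz⟩ := h.differentiableAt_xyz hp
  have hy := h.y_pos p hp
  have hr : 72 * x p * z p * (x p ^ 2 + z p ^ 2) * K + 7 * y p * (x p ^ 2 - z p ^ 2) * H = 0 :=
    (mul_eq_zero.1 (h.ae_relation hp)).resolve_left (mul_ne_zero hm hn)
  obtain ⟨hx', hy', hz'⟩ := h.contDiffOn_xyz
  have hd := pd_eq_zero_of_mul_eq_zero h.isOpen (h.contDiffOn_a.mul h.contDiffOn_e)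
    (g := fun q => 72 * x q * z q * (x q ^ 2 + z q ^ 2) * K + 7 * y q * (x q ^ 2 - z q ^ 2) * H)
    (by fun_prop) (fun q hq => h.ae_relation hq) hp (mul_ne_zero hm hn) 2
  simp (disch := first | positivity | fun_prop (disch := positivity)) only [pd_add, pd_mul,
      pd_pow, pd_const, pd_sub, h.pd_x2 p hp, h.pd_y2 p hp, h.pd_z2 p hp, Nat.cast_ofNat,
      Nat.reduceSub, pow_one, zero_mul, mul_zero, zero_add, add_zero] at hd
  have key : (-1512 * e p * y p * z p * (x p ^ 2 + z p ^ 2) ^ 3 / x p) * H = 0 := by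
    linear_combination (norm := (field_simp; ring))
      72 * x p * z p * (x p ^ 2 + z p ^ 2) * hd - (72 * e p * z p * (x p ^ 2 + z p ^ 2)
        * (6 * x p ^ 4 + 7 * x p ^ 2 * z p ^ 2 + 3 * z p ^ 4) / x p ^ 3) * hr
  have hH : H = 0 := by
    refine (mul_eq_zero.1 key).resolve_left ?_
    have := hx.ne'
    have := hy.ne'
    have := hz.ne'
    have : (x p ^ 2 + z p ^ 2) ≠ 0 := by positivity
    simp [*]
  refine ⟨hH, ?_⟩
  rw [hH, mul_zero, add_zero] at hr
  exact (mul_eq_zero.1 hr).resolve_left (by positivity)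

theorem b_relation (h : ReducedSystem U x y z a b e K H)
    (h1 : ∀ q ∈ U, b q * a q = 0) (h2 : ∀ q ∈ U, b q * e q = 0) (hp : p ∈ U) :
    b p * (y p * (8 * x p ^ 4 - 19 * x p ^ 2 * z p ^ 2 + 8 * z p ^ 4) * H
      + 36 * x p * z p * (x p ^ 2 + z p ^ 2) * (x p ^ 2 - z p ^ 2) * K) = 0 := by
  refine mul_eq_zero.2 (or_iff_not_imp_left.2 fun hn => ?_)
  have hx := h.x_pos p hp
  have hz := h.z_pos p hp
  have e1 := (mul_eq_zero.1 (h1 p hp)).resolve_left hn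
  have e2 := (mul_eq_zero.1 (h2 p hp)).resolve_left hn
  have d1 := pd_eq_zero_of_mul_eq_zero h.isOpen h.contDiffOn_b h.contDiffOn_a h1 hp hn 0
  have d2 := pd_eq_zero_of_mul_eq_zero h.isOpen h.contDiffOn_b h.contDiffOn_e h2 hp hn 2
  rw [h.pd_a0 p hp, e1, e2] at d1
  rw [h.pd_e2 p hp, e1, e2] at d2
  have hc := (mul_eq_zero.1 (h.compat_b hp)).resolve_left hn
  rw [e1, e2] at hc
  linear_combination (norm := (field_simp; ring))
    (hc + 180 * (x p ^ 2 + z p ^ 2) ^ 2 * x p ^ 3 * z p ^ 3 * (x p ^ 2 - z p ^ 2)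
      * ((z p ^ 5 / (x p * (x p ^ 2 + z p ^ 2) ^ 2)) * d1 + x p / z p * d2))
        / (-3 * x p ^ 3 * z p ^ 3 * (x p ^ 2 + z p ^ 2))

theorem eq_zero_of_b_ne_zero (h : ReducedSystem U x y z a b e K H)
    (h1 : ∀ q ∈ U, b q * a q = 0) (h2 : ∀ q ∈ U, b q * e q = 0) (hp : p ∈ U)
    (hn : b p ≠ 0) : H = 0 ∧ (x p ^ 2 - z p ^ 2) * K = 0 := by
  have hx := h.x_pos p hp
  have hz := h.z_pos p hp
  obtain ⟨dx, dy, dz⟩ := h.differentiableAt_xyz hp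
  have hy := h.y_pos p hp
  have hr : y p * (8 * x p ^ 4 - 19 * x p ^ 2 * z p ^ 2 + 8 * z p ^ 4) * H
    + 36 * x p * z p * (x p ^ 2 + z p ^ 2) * (x p ^ 2 - z p ^ 2) * K = 0 :=
    (mul_eq_zero.1 (h.b_relation h1 h2 hp)).resolve_left hn
  obtain ⟨hx', hy', hz'⟩ := h.contDiffOn_xyz
  have hd := pd_eq_zero_of_mul_eq_zero h.isOpen h.contDiffOn_b
    (g := fun q => y q * (8 * x q ^ 4 - 19 * x q ^ 2 * z q ^ 2 + 8 * z q ^ 4) * H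
      + 36 * x q * z q * (x q ^ 2 + z q ^ 2) * (x q ^ 2 - z q ^ 2) * K)
    (by fun_prop) (fun q hq => h.b_relation h1 h2 hq) hp hn 1
  simp (disch := first | positivity | fun_prop (disch := positivity)) only [pd_add, pd_mul,
      pd_pow, pd_const, pd_sub, h.pd_x1 p hp, h.pd_y1 p hp, h.pd_z1 p hp, Nat.cast_ofNat,
      Nat.reduceSub, pow_one, zero_mul, mul_zero, zero_add, add_zero] at hd
  have key : (15 * b p * y p * x p ^ 3 * (x p ^ 2 + z p ^ 2) * (x p ^ 2 - z p ^ 2)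
    * (2 * x p ^ 4 - 3 * x p ^ 2 * z p ^ 2 + 2 * z p ^ 4) / z p) * H = 0 := by
    linear_combination (norm := (field_simp; ring))
      x p * z p * (x p ^ 2 + z p ^ 2) * (x p ^ 2 - z p ^ 2) * hd
        - (5 * b p * x p * (x p ^ 2 + z p ^ 2) * (x p ^ 6 - x p ^ 4 * z p ^ 2 + x p ^ 2 * z p ^ 4
          - z p ^ 6) / z p ^ 3) * hr
  have hH : H = 0 := by
    rcases eq_or_ne (x p ^ 2 - z p ^ 2) 0 with hs | hs
    · have hr' : -(3 * y p * x p ^ 2 * z p ^ 2) * H = 0 := by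
        linear_combination
          hr - (8 * y p * (x p ^ 2 - z p ^ 2) * H + 36 * x p * z p * (x p ^ 2 + z p ^ 2) * K) * hs
      exact (mul_eq_zero.1 hr').resolve_left (neg_ne_zero.2 (by positivity))
    · refine (mul_eq_zero.1 key).resolve_left ?_
      have := hx.ne'
      have := hy.ne'
      have := hz.ne'
      have : 2 * x p ^ 4 - 3 * x p ^ 2 * z p ^ 2 + 2 * z p ^ 4 ≠ 0 := by
        have : 0 < 2 * (x p ^ 2 - z p ^ 2) ^ 2 + x p ^ 2 * z p ^ 2 := by positivity
        nlinarith
      have : (x p ^ 2 + z p ^ 2) ≠ 0 := by positivity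
      simp [*]
  refine ⟨hH, ?_⟩
  rw [hH, mul_zero, zero_add, mul_assoc] at hr
  exact (mul_eq_zero.1 hr).resolve_left (by positivity)

theorem a_relation (h : ReducedSystem U x y z a b e K H)
    (h1 : ∀ q ∈ U, a q * b q = 0) (h2 : ∀ q ∈ U, a q * e q = 0) (hp : p ∈ U) :
    a p * (y p * (8 * x p ^ 4 + 35 * x p ^ 2 * z p ^ 2 + 35 * z p ^ 4) * H
      + 36 * x p * z p * (x p ^ 2 + z p ^ 2) * (x p ^ 2 + 2 * z p ^ 2) * K) = 0 := by
  refine mul_eq_zero.2 (or_iff_not_imp_left.2 fun hn => ?_)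
  have hx := h.x_pos p hp
  have hz := h.z_pos p hp
  have e1 := (mul_eq_zero.1 (h1 p hp)).resolve_left hn
  have e2 := (mul_eq_zero.1 (h2 p hp)).resolve_left hn
  have d1 := pd_eq_zero_of_mul_eq_zero h.isOpen h.contDiffOn_a h.contDiffOn_b h1 hp hn 1
  have d2 := pd_eq_zero_of_mul_eq_zero h.isOpen h.contDiffOn_a h.contDiffOn_e h2 hp hn 2
  rw [h.pd_b1 p hp, e1, e2] at d1
  rw [h.pd_e2 p hp, e1, e2] at d2
  have hc := (mul_eq_zero.1 (h.compat_a hp)).resolve_left hn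
  rw [e1, e2] at hc
  linear_combination (norm := (field_simp; ring))
    (hc + 180 * (x p ^ 2 + z p ^ 2) * x p ^ 4 * z p ^ 3 * (x p ^ 2 + 2 * z p ^ 2)
      * (z p * d1 + (x p ^ 2 + z p ^ 2) ^ 3 / (z p * x p ^ 4) * d2))
        / (-3 * x p ^ 3 * z p ^ 3 * (x p ^ 2 + z p ^ 2))

theorem eq_zero_of_a_ne_zero (h : ReducedSystem U x y z a b e K H)
    (h1 : ∀ q ∈ U, a q * b q = 0) (h2 : ∀ q ∈ U, a q * e q = 0) (hp : p ∈ U)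
    (hn : a p ≠ 0) : H = 0 ∧ (x p ^ 2 + 2 * z p ^ 2) * K = 0 := by
  have hx := h.x_pos p hp
  have hz := h.z_pos p hp
  obtain ⟨dx, dy, dz⟩ := h.differentiableAt_xyz hp
  have hy := h.y_pos p hp
  have hr : y p * (8 * x p ^ 4 + 35 * x p ^ 2 * z p ^ 2 + 35 * z p ^ 4) * H
    + 36 * x p * z p * (x p ^ 2 + z p ^ 2) * (x p ^ 2 + 2 * z p ^ 2) * K = 0 :=
    (mul_eq_zero.1 (h.a_relation h1 h2 hp)).resolve_left hn
  obtain ⟨hx', hy', hz'⟩ := h.contDiffOn_xyz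
  have hd := pd_eq_zero_of_mul_eq_zero h.isOpen h.contDiffOn_a
    (g := fun q => y q * (8 * x q ^ 4 + 35 * x q ^ 2 * z q ^ 2 + 35 * z q ^ 4) * H
      + 36 * x q * z q * (x q ^ 2 + z q ^ 2) * (x q ^ 2 + 2 * z q ^ 2) * K)
    (by fun_prop) (fun q hq => h.a_relation h1 h2 hq) hp hn 0
  simp (disch := first | positivity | fun_prop (disch := positivity)) only [pd_add, pd_mul,
      pd_pow, pd_const, h.pd_x0 p hp, h.pd_y0 p hp, h.pd_z0 p hp, Nat.cast_ofNat, Nat.reduceSub,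
      pow_one, zero_mul, mul_zero, zero_add, add_zero] at hd
  have key : (-15 * a p * y p * x p * z p ^ 3 * (2 * x p ^ 6 + 11 * x p ^ 4 * z p ^ 2
    + 21 * x p ^ 2 * z p ^ 4 + 14 * z p ^ 6)) * H = 0 := by
    linear_combination (norm := (field_simp; ring))
      x p * z p * (x p ^ 2 + z p ^ 2) * (x p ^ 2 + 2 * z p ^ 2) * hd
        - (a p * x p * z p * (5 * x p ^ 6 + 19 * x p ^ 4 * z p ^ 2 + 26 * x p ^ 2 * z p ^ 4
          + 16 * z p ^ 6) / (x p ^ 2 + z p ^ 2)) * hr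
  have hH : H = 0 := by
    refine (mul_eq_zero.1 key).resolve_left ?_
    have := hx.ne'
    have := hy.ne'
    have := hz.ne'
    have : 2 * x p ^ 6 + 11 * x p ^ 4 * z p ^ 2 + 21 * x p ^ 2 * z p ^ 4 + 14 * z p ^ 6 ≠ 0 := by
      positivity
    have : (x p ^ 2 + z p ^ 2) ≠ 0 := by positivity
    simp [*]
  refine ⟨hH, ?_⟩
  rw [hH, mul_zero, zero_add, mul_assoc] at hr
  exact (mul_eq_zero.1 hr).resolve_left (by positivity)

theorem e_relation (h : ReducedSystem U x y z a b e K H)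
    (h1 : ∀ q ∈ U, e q * a q = 0) (h2 : ∀ q ∈ U, e q * b q = 0) (hp : p ∈ U) :
    e p * (y p * (35 * x p ^ 4 + 35 * x p ^ 2 * z p ^ 2 + 8 * z p ^ 4) * H
      + 36 * x p * z p * (x p ^ 2 + z p ^ 2) * (-2 * x p ^ 2 - z p ^ 2) * K) = 0 := by
  refine mul_eq_zero.2 (or_iff_not_imp_left.2 fun hn => ?_)
  have hx := h.x_pos p hp
  have hz := h.z_pos p hp
  have e1 := (mul_eq_zero.1 (h1 p hp)).resolve_left hn
  have e2 := (mul_eq_zero.1 (h2 p hp)).resolve_left hn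
  have d1 := pd_eq_zero_of_mul_eq_zero h.isOpen h.contDiffOn_e h.contDiffOn_a h1 hp hn 0
  have d2 := pd_eq_zero_of_mul_eq_zero h.isOpen h.contDiffOn_e h.contDiffOn_b h2 hp hn 1
  rw [h.pd_a0 p hp, e1, e2] at d1
  rw [h.pd_b1 p hp, e1, e2] at d2
  have hc := (mul_eq_zero.1 (h.compat_e hp)).resolve_left hn
  rw [e1, e2] at hc
  linear_combination (norm := (field_simp; ring))
    (hc + (-180) * (x p ^ 2 + z p ^ 2) * x p ^ 3 * z p ^ 4 * (2 * x p ^ 2 + z p ^ 2)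
      * ((x p ^ 2 + z p ^ 2) / x p * d1 + x p ^ 5 / z p ^ 4 * d2))
        / (-3 * x p ^ 3 * z p ^ 3 * (x p ^ 2 + z p ^ 2))

theorem eq_zero_of_e_ne_zero (h : ReducedSystem U x y z a b e K H)
    (h1 : ∀ q ∈ U, e q * a q = 0) (h2 : ∀ q ∈ U, e q * b q = 0) (hp : p ∈ U)
    (hn : e p ≠ 0) : H = 0 ∧ (-2 * x p ^ 2 - z p ^ 2) * K = 0 := by
  have hx := h.x_pos p hp
  have hz := h.z_pos p hp
  obtain ⟨dx, dy, dz⟩ := h.differentiableAt_xyz hp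
  have hy := h.y_pos p hp
  have hr : y p * (35 * x p ^ 4 + 35 * x p ^ 2 * z p ^ 2 + 8 * z p ^ 4) * H
    + 36 * x p * z p * (x p ^ 2 + z p ^ 2) * (-2 * x p ^ 2 - z p ^ 2) * K = 0 :=
    (mul_eq_zero.1 (h.e_relation h1 h2 hp)).resolve_left hn
  obtain ⟨hx', hy', hz'⟩ := h.contDiffOn_xyz
  have hd := pd_eq_zero_of_mul_eq_zero h.isOpen h.contDiffOn_e
    (g := fun q => y q * (35 * x q ^ 4 + 35 * x q ^ 2 * z q ^ 2 + 8 * z q ^ 4) * H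
      + 36 * x q * z q * (x q ^ 2 + z q ^ 2) * (-2 * x q ^ 2 - z q ^ 2) * K)
    (by fun_prop) (fun q hq => h.e_relation h1 h2 hq) hp hn 2
  simp (disch := first | positivity | fun_prop (disch := positivity)) only [pd_add, pd_mul,
      pd_pow, pd_const, pd_sub, h.pd_x2 p hp, h.pd_y2 p hp, h.pd_z2 p hp, Nat.cast_ofNat,
      Nat.reduceSub, pow_one, zero_mul, mul_zero, zero_add, add_zero] at hd
  have key : (15 * e p * y p * z p * (x p ^ 2 + z p ^ 2) ^ 2
    * (14 * x p ^ 6 + 21 * x p ^ 4 * z p ^ 2 + 11 * x p ^ 2 * z p ^ 4 + 2 * z p ^ 6) / x p) * H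
      = 0 := by
    linear_combination (norm := (field_simp; ring))
      x p * z p * (x p ^ 2 + z p ^ 2) * (-2 * x p ^ 2 - z p ^ 2) * hd
        - (e p * z p * (x p ^ 2 + z p ^ 2) * (-16 * x p ^ 6 - 26 * x p ^ 4 * z p ^ 2
          - 19 * x p ^ 2 * z p ^ 4 - 5 * z p ^ 6) / x p ^ 3) * hr
  have hH : H = 0 := by
    refine (mul_eq_zero.1 key).resolve_left ?_
    have := hx.ne'
    have := hy.ne'
    have := hz.ne'
    have : 14 * x p ^ 6 + 21 * x p ^ 4 * z p ^ 2 + 11 * x p ^ 2 * z p ^ 4 + 2 * z p ^ 6 ≠ 0 := by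
      positivity
    have : (x p ^ 2 + z p ^ 2) ≠ 0 := by positivity
    simp [*]
  refine ⟨hH, ?_⟩
  rw [hH, mul_zero, zero_add, mul_assoc] at hr
  exact (mul_eq_zero.1 hr).resolve_left (by positivity)

theorem b_eq_zero_or (h : ReducedSystem U x y z a b e K H) (hp : p ∈ U) :
    b p = 0 ∨ H = 0 ∧ (x p ^ 2 - z p ^ 2) * K = 0 := by
  by_cases hHK : H = 0 ∧ K = 0
  · exact Or.inr ⟨hHK.1, by rw [hHK.2, mul_zero]⟩
  refine or_iff_not_imp_left.2 fun hb => h.eq_zero_of_b_ne_zero (fun q hq => ?_)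
    (fun q hq => ?_) hp hb
  · by_contra hne
    exact hHK (h.eq_zero_of_a_b_ne_zero hq (right_ne_zero_of_mul hne) (left_ne_zero_of_mul hne))
  · by_contra hne
    exact hHK (h.eq_zero_of_b_e_ne_zero hq (left_ne_zero_of_mul hne) (right_ne_zero_of_mul hne))

theorem a_eq_zero_or (h : ReducedSystem U x y z a b e K H) (hp : p ∈ U) :
    a p = 0 ∨ H = 0 ∧ (x p ^ 2 + 2 * z p ^ 2) * K = 0 := by
  by_cases hHK : H = 0 ∧ K = 0
  · exact Or.inr ⟨hHK.1, by rw [hHK.2, mul_zero]⟩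
  refine or_iff_not_imp_left.2 fun ha => h.eq_zero_of_a_ne_zero (fun q hq => ?_)
    (fun q hq => ?_) hp ha
  · by_contra hne
    exact hHK (h.eq_zero_of_a_b_ne_zero hq (left_ne_zero_of_mul hne) (right_ne_zero_of_mul hne))
  · by_contra hne
    exact hHK (h.eq_zero_of_a_e_ne_zero hq (left_ne_zero_of_mul hne) (right_ne_zero_of_mul hne))

theorem e_eq_zero_or (h : ReducedSystem U x y z a b e K H) (hp : p ∈ U) :
    e p = 0 ∨ H = 0 ∧ (-2 * x p ^ 2 - z p ^ 2) * K = 0 := by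
  by_cases hHK : H = 0 ∧ K = 0
  · exact Or.inr ⟨hHK.1, by rw [hHK.2, mul_zero]⟩
  refine or_iff_not_imp_left.2 fun he => h.eq_zero_of_e_ne_zero (fun q hq => ?_)
    (fun q hq => ?_) hp he
  · by_contra hne
    exact hHK (h.eq_zero_of_a_e_ne_zero hq (right_ne_zero_of_mul hne) (left_ne_zero_of_mul hne))
  · by_contra hne
    exact hHK (h.eq_zero_of_b_e_ne_zero hq (right_ne_zero_of_mul hne) (left_ne_zero_of_mul hne))

end ReducedSystem

namespace Hypo

variable {U : Set (Fin 3 → ℝ)} {v V : Fin 3 → (Fin 3 → ℝ) → ℝ} {c H : ℝ} {p : Fin 3 → ℝ}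

theorem contDiffOn_al (hyp : Hypo U v V c H) (i : Fin 3) :
    ContDiffOn ℝ (⊤ : ℕ∞) (al v i) U :=
  (contDiffOn_const.div (hyp.smooth_v _) fun q hq => (hyp.pos _ q hq).ne').mul
    (contDiffOn_pd hyp.hopen (hyp.smooth_v _) i)

theorem pd_succ (hyp : Hypo U v V c H) (i : Fin 3) (hp : p ∈ U) :
    pd i (v (i + 1)) p = al v i p * v (i + 1) p := by
  have := (hyp.pos (i + 1) p hp).ne'
  unfold al
  field_simp

theorem differentiableAt (hyp : Hypo U v V c H) (i : Fin 3) (hp : p ∈ U) :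
    DifferentiableAt ℝ (v i) p :=
  ContDiffOn.differentiableAt_of_isOpen hyp.hopen (hyp.smooth_v i) hp

theorem differentiableAt_xyz (hyp : Hypo U v V c H) (hp : p ∈ U) :
    DifferentiableAt ℝ (v 0) p ∧ DifferentiableAt ℝ (v 1) p ∧ DifferentiableAt ℝ (v 2) p :=
  ⟨hyp.differentiableAt 0 hp, hyp.differentiableAt 1 hp, hyp.differentiableAt 2 hp⟩

theorem pos_xyz (hyp : Hypo U v V c H) (hp : p ∈ U) : 0 < v 0 p ∧ 0 < v 1 p ∧ 0 < v 2 p :=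
  ⟨hyp.pos 0 p hp, hyp.pos 1 p hp, hyp.pos 2 p hp⟩

theorem pd_sq (hyp : Hypo U v V c H) (i : Fin 3) (hp : p ∈ U) :
    v 1 p * pd i (v 1) p = v 0 p * pd i (v 0) p + v 2 p * pd i (v 2) p := by
  obtain ⟨dx, dy, dz⟩ := hyp.differentiableAt_xyz hp
  have hc := pd_congr hyp.hopen hyp.ansatz_v hp i
  simp (disch := fun_prop) only [pd_add, pd_pow, Nat.cast_ofNat, Nat.reduceSub, pow_one] at hc
  linear_combination hc / 2

theorem pow_three_eq (hyp : Hypo U v V c H) (hp : p ∈ U) :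
    v 1 p ^ 3 = v 1 p * (v 0 p ^ 2 + v 2 p ^ 2) := by
  linear_combination v 1 p * hyp.ansatz_v p hp

theorem pow_four_eq (hyp : Hypo U v V c H) (hp : p ∈ U) :
    v 1 p ^ 4 = (v 0 p ^ 2 + v 2 p ^ 2) ^ 2 := by
  rw [← hyp.ansatz_v p hp]
  ring

theorem pow_five_eq (hyp : Hypo U v V c H) (hp : p ∈ U) :
    v 1 p ^ 5 = v 1 p * (v 0 p ^ 2 + v 2 p ^ 2) ^ 2 := by
  rw [← hyp.ansatz_v p hp]
  ring

theorem pow_six_eq (hyp : Hypo U v V c H) (hp : p ∈ U) :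
    v 1 p ^ 6 = (v 0 p ^ 2 + v 2 p ^ 2) ^ 3 := by
  rw [← hyp.ansatz_v p hp]
  ring

theorem pd_y0 (hyp : Hypo U v V c H) (hp : p ∈ U) :
    pd 0 (v 1) p =
        al v 0 p * v 1 p :=
  hyp.pd_succ 0 hp

theorem pd_z1 (hyp : Hypo U v V c H) (hp : p ∈ U) :
    pd 1 (v 2) p =
        al v 1 p * v 2 p :=
  hyp.pd_succ 1 hp

theorem pd_x2 (hyp : Hypo U v V c H) (hp : p ∈ U) :
    pd 2 (v 0) p =
        al v 2 p * v 0 p :=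
  hyp.pd_succ 2 hp

theorem pd_x1 (hyp : Hypo U v V c H) (hp : p ∈ U) :
    pd 1 (v 0) p =
        al v 1 p * v 0 p ^ 5 / (v 2 p ^ 4) := by
  obtain ⟨dx, dy, dz⟩ := hyp.differentiableAt_xyz hp
  obtain ⟨hx, hy, hz⟩ := hyp.pos_xyz hp
  have hd := hyp.pd_sq 1 hp
  have hc := hyp.holiv 0 1 (by decide) p hp
  rw [pd_congr hyp.hopen hyp.ansatz_V1 hp, hh, hyp.ansatz_V2 p hp] at hc
  simp (disch := first | positivity | fun_prop (disch := positivity)) only [pd_add, pd_mul,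
      pd_div, pd_const, hyp.pd_z1 hp, zero_mul, mul_zero, zero_add, add_zero] at hc hd
  linear_combination (norm := (
      field_simp
      ring_nf
      simp only [hyp.ansatz_v p hp,
        hyp.pow_three_eq hp, hyp.pow_four_eq hp]
      ring))
    v 0 p / v 2 p ^ 4 * (-3 * v 1 p ^ 3 * v 2 p * hc - v 0 p ^ 2 * hd)

theorem pd_z0 (hyp : Hypo U v V c H) (hp : p ∈ U) :
    pd 0 (v 2) p =
        al v 0 p * v 2 p ^ 5 / ((v 0 p ^ 2 + v 2 p ^ 2) ^ 2) := by
  obtain ⟨dx, dy, dz⟩ := hyp.differentiableAt_xyz hp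
  obtain ⟨hx, hy, hz⟩ := hyp.pos_xyz hp
  have hd := hyp.pd_sq 0 hp
  have hc := hyp.holiv 1 0 (by decide) p hp
  rw [pd_congr hyp.hopen hyp.ansatz_V2 hp, hh, hyp.ansatz_V1 p hp] at hc
  simp (disch := first | positivity | fun_prop (disch := positivity)) only [pd_add, pd_sub,
      pd_mul, pd_div, pd_const, hyp.pd_y0 hp, zero_mul, mul_zero, zero_add, add_zero] at hc hd
  linear_combination (norm := (
      field_simp
      ring_nf
      simp only [hyp.ansatz_v p hp]
      ring))
    3 * v 0 p ^ 3 * v 2 p ^ 2 / (v 0 p ^ 2 + v 2 p ^ 2) ^ 2 * hc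
      - v 2 p / (v 0 p ^ 2 + v 2 p ^ 2) * hd

theorem pd_y2 (hyp : Hypo U v V c H) (hp : p ∈ U) :
    pd 2 (v 1) p =
        al v 2 p * v 1 p * (v 0 p ^ 2 + v 2 p ^ 2) ^ 2 / (v 0 p ^ 4) := by
  obtain ⟨dx, dy, dz⟩ := hyp.differentiableAt_xyz hp
  obtain ⟨hx, hy, hz⟩ := hyp.pos_xyz hp
  have hd := hyp.pd_sq 2 hp
  have hc := hyp.holiv 0 2 (by decide) p hp
  rw [pd_congr hyp.hopen hyp.ansatz_V1 hp, hh, hyp.ansatz_V3 p hp] at hc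
  simp (disch := first | positivity | fun_prop (disch := positivity)) only [pd_add, pd_mul,
      pd_div, pd_const, hyp.pd_x2 hp, zero_mul, mul_zero, zero_add, add_zero] at hc hd
  linear_combination (norm := (
      field_simp
      ring_nf
      simp only [hyp.ansatz_v p hp,
        hyp.pow_three_eq hp, hyp.pow_four_eq hp]
      ring))
    -v 2 p ^ 2 / (v 0 p ^ 4 * v 1 p) * (-3 * v 1 p ^ 3 * v 2 p * hc
      - v 0 p ^ 2 * (v 0 p ^ 2 + v 2 p ^ 2) / v 2 p ^ 2 * hd)

theorem pd_x0 (hyp : Hypo U v V c H) (hp : p ∈ U) :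
    pd 0 (v 0) p =
        al v 0 p * v 0 p * (v 0 p ^ 4 + 3 * v 0 p ^ 2 * v 2 p ^ 2 + 3 * v 2 p ^ 4)
          / ((v 0 p ^ 2 + v 2 p ^ 2) ^ 2) := by
  obtain ⟨hx, hy, hz⟩ := hyp.pos_xyz hp
  have hd := hyp.pd_sq 0 hp
  rw [hyp.pd_y0 hp, hyp.pd_z0 hp] at hd
  linear_combination (norm := (
      field_simp
      ring_nf
      simp only [hyp.ansatz_v p hp]
      ring))
    -hd / v 0 p

theorem pd_y1 (hyp : Hypo U v V c H) (hp : p ∈ U) :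
    pd 1 (v 1) p =
        al v 1 p * v 1 p * (v 0 p ^ 4 - v 0 p ^ 2 * v 2 p ^ 2 + v 2 p ^ 4) / (v 2 p ^ 4) := by
  obtain ⟨hx, hy, hz⟩ := hyp.pos_xyz hp
  have hd := hyp.pd_sq 1 hp
  rw [hyp.pd_x1 hp, hyp.pd_z1 hp] at hd
  linear_combination (norm := (
      field_simp
      ring_nf
      simp only [hyp.ansatz_v p hp]
      ring))
    hd / v 1 p

theorem pd_z2 (hyp : Hypo U v V c H) (hp : p ∈ U) :
    pd 2 (v 2) p =
        al v 2 p * v 2 p * (3 * v 0 p ^ 4 + 3 * v 0 p ^ 2 * v 2 p ^ 2 + v 2 p ^ 4)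
          / (v 0 p ^ 4) := by
  obtain ⟨hx, hy, hz⟩ := hyp.pos_xyz hp
  have hd := hyp.pd_sq 2 hp
  rw [hyp.pd_x2 hp, hyp.pd_y2 hp] at hd
  linear_combination (norm := (
      field_simp
      ring_nf
      simp only [hyp.ansatz_v p hp]
      ring))
    -hd / v 2 p

theorem hh_eq_01 (hyp : Hypo U v V c H) :
    Set.EqOn (hh v 0 1) (fun q => al v 0 q * v 1 q / v 0 q) U := by
  intro p hp
  obtain ⟨hx, hy, hz⟩ := hyp.pos_xyz hp
  simp only [hh, hyp.pd_y0 hp]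
  field_simp

theorem hh_eq_02 (hyp : Hypo U v V c H) :
    Set.EqOn (hh v 0 2) (fun q => al v 0 q * v 2 q ^ 5
      / (v 0 q * (v 0 q ^ 2 + v 2 q ^ 2) ^ 2)) U := by
  intro p hp
  obtain ⟨hx, hy, hz⟩ := hyp.pos_xyz hp
  simp only [hh, hyp.pd_z0 hp]
  field_simp

theorem hh_eq_10 (hyp : Hypo U v V c H) :
    Set.EqOn (hh v 1 0) (fun q => al v 1 q * v 0 q ^ 5 * v 1 q
      / ((v 0 q ^ 2 + v 2 q ^ 2) * v 2 q ^ 4)) U := by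
  intro p hp
  obtain ⟨hx, hy, hz⟩ := hyp.pos_xyz hp
  simp only [hh, hyp.pd_x1 hp]
  field_simp
  ring_nf
  simp only [hyp.ansatz_v p hp]
  ring

theorem hh_eq_12 (hyp : Hypo U v V c H) :
    Set.EqOn (hh v 1 2) (fun q => al v 1 q * v 2 q * v 1 q / (v 0 q ^ 2 + v 2 q ^ 2)) U := by
  intro p hp
  obtain ⟨hx, hy, hz⟩ := hyp.pos_xyz hp
  simp only [hh, hyp.pd_z1 hp]
  field_simp
  ring_nf
  simp only [hyp.ansatz_v p hp]
  ring

theorem hh_eq_20 (hyp : Hypo U v V c H) :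
    Set.EqOn (hh v 2 0) (fun q => al v 2 q * v 0 q / v 2 q) U := by
  intro p hp
  obtain ⟨hx, hy, hz⟩ := hyp.pos_xyz hp
  simp only [hh, hyp.pd_x2 hp]
  field_simp

theorem hh_eq_21 (hyp : Hypo U v V c H) :
    Set.EqOn (hh v 2 1) (fun q => al v 2 q * v 1 q * (v 0 q ^ 2 + v 2 q ^ 2) ^ 2
      / (v 2 q * v 0 q ^ 4)) U := by
  intro p hp
  obtain ⟨hx, hy, hz⟩ := hyp.pos_xyz hp
  simp only [hh, hyp.pd_y2 hp]
  field_simp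

theorem pd_a0 (hyp : Hypo U v V c H) (hp : p ∈ U) :
    pd 0 (al v 0) p =
        H * v 1 p * v 0 p * (v 0 p ^ 2 + 2 * v 2 p ^ 2) / (18 * v 2 p ^ 3)
        + al v 0 p ^ 2 * (3 * v 0 p ^ 4 + 6 * v 0 p ^ 2 * v 2 p ^ 2 + 2 * v 2 p ^ 4)
          / ((v 0 p ^ 2 + v 2 p ^ 2) ^ 2)
        + al v 1 p ^ 2 * v 0 p ^ 6 * (-3 * v 0 p ^ 2 + 2 * v 2 p ^ 2) / (v 2 p ^ 8)
        + al v 2 p ^ 2 * (v 0 p ^ 2 + v 2 p ^ 2) ^ 2 * (5 * v 0 p ^ 2 + 2 * v 2 p ^ 2)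
          / (v 0 p ^ 2 * v 2 p ^ 4)
        + (c + H ^ 2 / 9) * v 0 p ^ 2 * (v 0 p ^ 2 + v 2 p ^ 2) * (-1) / (v 2 p ^ 2)
        + (5 * v 0 p ^ 4 + 2 * v 0 p ^ 2 * v 2 p ^ 2 + 2 * v 2 p ^ 4) / (9 * v 2 p ^ 4) := by
  obtain ⟨dx, dy, dz⟩ := hyp.differentiableAt_xyz hp
  have da := ContDiffOn.differentiableAt_of_isOpen hyp.hopen (hyp.contDiffOn_al 0) hp
  have db := ContDiffOn.differentiableAt_of_isOpen hyp.hopen (hyp.contDiffOn_al 1) hp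
  have de := ContDiffOn.differentiableAt_of_isOpen hyp.hopen (hyp.contDiffOn_al 2) hp
  obtain ⟨hx, hy, hz⟩ := hyp.pos_xyz hp
  have h1 := hyp.holiii 0 1 2 (by decide) (by decide) (by decide) p hp
  rw [pd_congr hyp.hopen hyp.hh_eq_01 hp, pd_congr hyp.hopen hyp.hh_eq_10 hp,
    hyp.hh_eq_20 hp, hyp.hh_eq_21 hp, hyp.ansatz_V1 p hp, hyp.ansatz_V2 p hp] at h1
  simp (disch := first | positivity | fun_prop (disch := positivity)) only [pd_add, pd_mul,
      pd_div, pd_pow, hyp.pd_x0 hp, hyp.pd_y0 hp, hyp.pd_x1 hp, hyp.pd_y1 hp, hyp.pd_z1 hp,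
      Nat.cast_ofNat, Nat.reduceSub, pow_one] at h1
  have h2 := hyp.holiii 0 2 1 (by decide) (by decide) (by decide) p hp
  rw [pd_congr hyp.hopen hyp.hh_eq_02 hp, pd_congr hyp.hopen hyp.hh_eq_20 hp,
    hyp.hh_eq_10 hp, hyp.hh_eq_12 hp, hyp.ansatz_V1 p hp, hyp.ansatz_V3 p hp] at h2
  simp (disch := first | positivity | fun_prop (disch := positivity)) only [pd_add, pd_mul,
      pd_div, pd_pow, hyp.pd_x0 hp, hyp.pd_z0 hp, hyp.pd_x2 hp, hyp.pd_z2 hp, Nat.cast_ofNat,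
      Nat.reduceSub, pow_one] at h2
  have h3 := hyp.holiii 1 2 0 (by decide) (by decide) (by decide) p hp
  rw [pd_congr hyp.hopen hyp.hh_eq_12 hp, pd_congr hyp.hopen hyp.hh_eq_21 hp,
    hyp.hh_eq_01 hp, hyp.hh_eq_02 hp, hyp.ansatz_V2 p hp, hyp.ansatz_V3 p hp] at h3
  simp (disch := first | positivity | fun_prop (disch := positivity)) only [pd_add, pd_mul,
      pd_div, pd_pow, hyp.pd_x1 hp, hyp.pd_y1 hp, hyp.pd_z1 hp, hyp.pd_x2 hp, hyp.pd_y2 hp,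
      hyp.pd_z2 hp, Nat.cast_ofNat, Nat.reduceSub, pow_one] at h3
  linear_combination (norm := (
      field_simp
      ring_nf
      simp only [hyp.ansatz_v p hp,
        hyp.pow_three_eq hp, hyp.pow_four_eq hp]
      ring))
    v 0 p / (2 * v 1 p) * h1 - v 0 p ^ 6 / (2 * v 2 p ^ 5 * v 1 p) * h3
      + v 0 p * (v 0 p ^ 2 + v 2 p ^ 2) ^ 2 / (2 * v 2 p ^ 5) * h2

theorem reducedSystem (hyp : Hypo U v V c H) :
    ReducedSystem U (v 0) (v 1) (v 2) (al v 0) (al v 1) (al v 2) (c + H ^ 2 / 9) H where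
  isOpen := hyp.hopen
  contDiffOn_x := hyp.smooth_v 0
  contDiffOn_y := hyp.smooth_v 1
  contDiffOn_z := hyp.smooth_v 2
  contDiffOn_a := hyp.contDiffOn_al 0
  contDiffOn_b := hyp.contDiffOn_al 1
  contDiffOn_e := hyp.contDiffOn_al 2
  x_pos := hyp.pos 0
  y_pos := hyp.pos 1
  z_pos := hyp.pos 2
  sq_eq := hyp.ansatz_v
  pd_x0 _ hq := hyp.pd_x0 hq
  pd_x1 _ hq := hyp.pd_x1 hq
  pd_x2 _ hq := hyp.pd_x2 hq
  pd_y0 _ hq := hyp.pd_y0 hq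
  pd_y1 _ hq := hyp.pd_y1 hq
  pd_y2 _ hq := hyp.pd_y2 hq
  pd_z0 _ hq := hyp.pd_z0 hq
  pd_z1 _ hq := hyp.pd_z1 hq
  pd_z2 _ hq := hyp.pd_z2 hq
  pd_a0 _ hq := hyp.pd_a0 hq
  pd_a1 p hp := by
    obtain ⟨dx, dy, dz⟩ := hyp.differentiableAt_xyz hp
    have da := ContDiffOn.differentiableAt_of_isOpen hyp.hopen (hyp.contDiffOn_al 0) hp
    obtain ⟨hx, hy, hz⟩ := hyp.pos_xyz hp
    have hc := hyp.holii 0 1 2 (by decide) (by decide) (by decide) p hp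
    rw [pd_congr hyp.hopen hyp.hh_eq_02 hp, hyp.hh_eq_01 hp, hyp.hh_eq_12 hp] at hc
    simp (disch := first | positivity | fun_prop (disch := positivity)) only [pd_add, pd_mul,
        pd_div, pd_pow, hyp.pd_x1 hp, hyp.pd_z1 hp, Nat.cast_ofNat, Nat.reduceSub, pow_one] at hc
    linear_combination (norm := (
        field_simp
        ring_nf
        simp only [hyp.ansatz_v p hp]
        ring))
      hc / (v 2 p ^ 5 / (v 0 p * (v 0 p ^ 2 + v 2 p ^ 2) ^ 2))
  pd_a2 p hp := by
    obtain ⟨dx, dy, dz⟩ := hyp.differentiableAt_xyz hp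
    have da := ContDiffOn.differentiableAt_of_isOpen hyp.hopen (hyp.contDiffOn_al 0) hp
    obtain ⟨hx, hy, hz⟩ := hyp.pos_xyz hp
    have hc := hyp.holii 0 2 1 (by decide) (by decide) (by decide) p hp
    rw [pd_congr hyp.hopen hyp.hh_eq_01 hp, hyp.hh_eq_02 hp, hyp.hh_eq_21 hp] at hc
    simp (disch := first | positivity | fun_prop (disch := positivity)) only [pd_mul, pd_div,
        hyp.pd_x2 hp, hyp.pd_y2 hp] at hc
    linear_combination (norm := (field_simp; ring))
      hc / (v 1 p / v 0 p)
  pd_b0 p hp := by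
    obtain ⟨dx, dy, dz⟩ := hyp.differentiableAt_xyz hp
    have db := ContDiffOn.differentiableAt_of_isOpen hyp.hopen (hyp.contDiffOn_al 1) hp
    obtain ⟨hx, hy, hz⟩ := hyp.pos_xyz hp
    have hc := hyp.holii 1 0 2 (by decide) (by decide) (by decide) p hp
    rw [pd_congr hyp.hopen hyp.hh_eq_12 hp, hyp.hh_eq_10 hp, hyp.hh_eq_02 hp] at hc
    simp (disch := first | positivity | fun_prop (disch := positivity)) only [pd_add, pd_mul,
        pd_div, pd_pow, hyp.pd_x0 hp, hyp.pd_y0 hp, hyp.pd_z0 hp, Nat.cast_ofNat, Nat.reduceSub,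
        pow_one] at hc
    linear_combination (norm := (field_simp; ring))
      hc / (v 2 p * v 1 p / (v 0 p ^ 2 + v 2 p ^ 2))
  pd_b1 p hp := by
    obtain ⟨dx, dy, dz⟩ := hyp.differentiableAt_xyz hp
    have da := ContDiffOn.differentiableAt_of_isOpen hyp.hopen (hyp.contDiffOn_al 0) hp
    have db := ContDiffOn.differentiableAt_of_isOpen hyp.hopen (hyp.contDiffOn_al 1) hp
    obtain ⟨hx, hy, hz⟩ := hyp.pos_xyz hp
    have h1 := hyp.holiii 0 1 2 (by decide) (by decide) (by decide) p hp
    rw [pd_congr hyp.hopen hyp.hh_eq_01 hp, pd_congr hyp.hopen hyp.hh_eq_10 hp,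
      hyp.hh_eq_20 hp, hyp.hh_eq_21 hp, hyp.ansatz_V1 p hp, hyp.ansatz_V2 p hp] at h1
    simp (disch := first | positivity | fun_prop (disch := positivity)) only [pd_add, pd_mul,
        pd_div, pd_pow, hyp.pd_x0 hp, hyp.pd_y0 hp, hyp.pd_x1 hp, hyp.pd_y1 hp, hyp.pd_z1 hp,
        Nat.cast_ofNat, Nat.reduceSub, pow_one] at h1
    rw [hyp.pd_a0 hp] at h1
    linear_combination (norm := (
        field_simp
        ring_nf
        simp only [hyp.ansatz_v p hp,
          hyp.pow_three_eq hp]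
        ring))
      (v 0 p ^ 2 + v 2 p ^ 2) * v 2 p ^ 4 / (v 0 p ^ 5 * v 1 p) * h1
  pd_b2 p hp := by
    obtain ⟨dx, dy, dz⟩ := hyp.differentiableAt_xyz hp
    have db := ContDiffOn.differentiableAt_of_isOpen hyp.hopen (hyp.contDiffOn_al 1) hp
    obtain ⟨hx, hy, hz⟩ := hyp.pos_xyz hp
    have hc := hyp.holii 1 2 0 (by decide) (by decide) (by decide) p hp
    rw [pd_congr hyp.hopen hyp.hh_eq_10 hp, hyp.hh_eq_12 hp, hyp.hh_eq_20 hp] at hc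
    simp (disch := first | positivity | fun_prop (disch := positivity)) only [pd_add, pd_mul,
        pd_div, pd_pow, hyp.pd_x2 hp, hyp.pd_y2 hp, hyp.pd_z2 hp, Nat.cast_ofNat, Nat.reduceSub,
        pow_one] at hc
    linear_combination (norm := (field_simp; ring))
      hc / (v 0 p ^ 5 * v 1 p / ((v 0 p ^ 2 + v 2 p ^ 2) * v 2 p ^ 4))
  pd_e0 p hp := by
    obtain ⟨dx, dy, dz⟩ := hyp.differentiableAt_xyz hp
    have de := ContDiffOn.differentiableAt_of_isOpen hyp.hopen (hyp.contDiffOn_al 2) hp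
    obtain ⟨hx, hy, hz⟩ := hyp.pos_xyz hp
    have hc := hyp.holii 2 0 1 (by decide) (by decide) (by decide) p hp
    rw [pd_congr hyp.hopen hyp.hh_eq_21 hp, hyp.hh_eq_20 hp, hyp.hh_eq_01 hp] at hc
    simp (disch := first | positivity | fun_prop (disch := positivity)) only [pd_add, pd_mul,
        pd_div, pd_pow, hyp.pd_x0 hp, hyp.pd_y0 hp, hyp.pd_z0 hp, Nat.cast_ofNat, Nat.reduceSub,
        pow_one] at hc
    linear_combination (norm := (field_simp; ring))
      hc / (v 1 p * (v 0 p ^ 2 + v 2 p ^ 2) ^ 2 / (v 2 p * v 0 p ^ 4))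
  pd_e1 p hp := by
    obtain ⟨dx, dy, dz⟩ := hyp.differentiableAt_xyz hp
    have de := ContDiffOn.differentiableAt_of_isOpen hyp.hopen (hyp.contDiffOn_al 2) hp
    obtain ⟨hx, hy, hz⟩ := hyp.pos_xyz hp
    have hc := hyp.holii 2 1 0 (by decide) (by decide) (by decide) p hp
    rw [pd_congr hyp.hopen hyp.hh_eq_20 hp, hyp.hh_eq_21 hp, hyp.hh_eq_10 hp] at hc
    simp (disch := first | positivity | fun_prop (disch := positivity)) only [pd_mul, pd_div,
        hyp.pd_x1 hp, hyp.pd_z1 hp] at hc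
    linear_combination (norm := (
        field_simp
        ring_nf
        simp only [hyp.ansatz_v p hp]
        ring))
      hc / (v 0 p / v 2 p)
  pd_e2 p hp := by
    obtain ⟨dx, dy, dz⟩ := hyp.differentiableAt_xyz hp
    have da := ContDiffOn.differentiableAt_of_isOpen hyp.hopen (hyp.contDiffOn_al 0) hp
    have de := ContDiffOn.differentiableAt_of_isOpen hyp.hopen (hyp.contDiffOn_al 2) hp
    obtain ⟨hx, hy, hz⟩ := hyp.pos_xyz hp
    have h2 := hyp.holiii 0 2 1 (by decide) (by decide) (by decide) p hp
    rw [pd_congr hyp.hopen hyp.hh_eq_02 hp, pd_congr hyp.hopen hyp.hh_eq_20 hp,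
      hyp.hh_eq_10 hp, hyp.hh_eq_12 hp, hyp.ansatz_V1 p hp, hyp.ansatz_V3 p hp] at h2
    simp (disch := first | positivity | fun_prop (disch := positivity)) only [pd_add, pd_mul,
        pd_div, pd_pow, hyp.pd_x0 hp, hyp.pd_z0 hp, hyp.pd_x2 hp, hyp.pd_z2 hp, Nat.cast_ofNat,
        Nat.reduceSub, pow_one] at h2
    rw [hyp.pd_a0 hp] at h2
    linear_combination (norm := (
        field_simp
        ring_nf
        simp only [hyp.ansatz_v p hp,
          hyp.pow_three_eq hp, hyp.pow_four_eq hp]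
        ring))
      v 2 p / v 0 p * h2

theorem Fexpr_eq (hyp : Hypo U v V c H) (hp : p ∈ U) :
    Fexpr v p = (9 * v 0 p ^ 2 * v 2 p ^ 8 * (v 0 p ^ 2 + 2 * v 2 p ^ 2) * al v 0 p ^ 2
        + 9 * v 0 p ^ 8 * (v 0 p ^ 2 + v 2 p ^ 2) * (v 0 p ^ 2 - v 2 p ^ 2) * al v 1 p ^ 2
        - 9 * (v 0 p ^ 2 + v 2 p ^ 2) ^ 4 * v 2 p ^ 2 * (2 * v 0 p ^ 2 + v 2 p ^ 2) * al v 2 p ^ 2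
        - v 0 p ^ 2 * v 2 p ^ 2 * (v 0 p ^ 2 + v 2 p ^ 2) * (v 0 p ^ 2 - v 2 p ^ 2)
          * (2 * v 0 p ^ 2 + v 2 p ^ 2) * (v 0 p ^ 2 + 2 * v 2 p ^ 2))
      / (27 * v 0 p * v 1 p * v 2 p) := by
  have h4 := hyp.pow_four_eq hp
  have h8 : v 1 p ^ 8 = (v 0 p ^ 2 + v 2 p ^ 2) ^ 4 := by
    rw [← hyp.ansatz_v p hp]
    ring
  rw [Fexpr, h4, h8, hyp.ansatz_v p hp]
  ring

end Hypo

theorem statement_2 (U : Set (Fin 3 → ℝ)) (v V : Fin 3 → (Fin 3 → ℝ) → ℝ) (c H : ℝ)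
    (hyp : Hypo U v V c H) : ∀ p ∈ U,
    (((30 * v 0 p / (v 1 p * (v 2 p) ^ 9)) * Fexpr v p
        - (4 * (v 0 p) ^ 4 * (v 1 p) ^ 2 / (v 2 p) ^ 6) * ((v 0 p) ^ 2 - (v 2 p) ^ 2) * c
        + ((v 0 p) ^ 3 * v 1 p / (18 * (v 2 p) ^ 7)) * m2expr v H p * H) * al v 1 p = 0) ∧
    (((30 * v 1 p / ((v 0 p) ^ 9 * v 2 p)) * Fexpr v p
        + (4 * (v 1 p) ^ 4 * (v 2 p) ^ 2 / (v 0 p) ^ 6) * ((v 0 p) ^ 2 + (v 1 p) ^ 2) * c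
        + (v 2 p * (v 1 p) ^ 3 / (18 * (v 0 p) ^ 7)) * m3expr v H p * H) * al v 2 p = 0) ∧
    (((30 * v 2 p / (v 0 p * (v 1 p) ^ 9)) * Fexpr v p
        - (4 * (v 0 p) ^ 2 * (v 2 p) ^ 4 / (v 1 p) ^ 6) * ((v 1 p) ^ 2 + (v 2 p) ^ 2) * c
        + (v 0 p * (v 2 p) ^ 3 / (18 * (v 1 p) ^ 7)) * m1expr v H p * H) * al v 0 p = 0) := by
  intro p hp
  have h := hyp.reducedSystem
  obtain ⟨hx, hy, hz⟩ := hyp.pos_xyz hp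
  have h2 := hyp.ansatz_v p hp
  have h4 := hyp.pow_four_eq hp
  have h6 := hyp.pow_six_eq hp
  have h10 : v 1 p ^ 10 = (v 0 p ^ 2 + v 2 p ^ 2) ^ 5 := by
    rw [← h2]
    ring
  refine ⟨?_, ?_, ?_⟩
  · rcases h.b_eq_zero_or hp with h0 | ⟨rfl, hK⟩
    · rw [h0, mul_zero]
    have hc := h.compat_b hp
    rw [hyp.Fexpr_eq hp]
    linear_combination (norm := (field_simp; simp only [h2, h4]; ring))
      1 / (18 * v 2 p ^ 10 * (v 0 p ^ 2 + v 2 p ^ 2)) * hc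
        - 8 * v 0 p ^ 4 * (v 0 p ^ 2 + v 2 p ^ 2) / v 2 p ^ 6 * al v 1 p * hK
  · rcases h.e_eq_zero_or hp with h0 | ⟨rfl, hK⟩
    · rw [h0, mul_zero]
    have hc := h.compat_e hp
    rw [hyp.Fexpr_eq hp]
    linear_combination (norm := (field_simp; simp only [h2, h4]; ring))
      1 / (18 * v 0 p ^ 10 * v 2 p ^ 2) * hc - 8 * (v 0 p ^ 2 + v 2 p ^ 2) ^ 2 * v 2 p ^ 2
        / v 0 p ^ 6 * al v 2 p * hK
  · rcases h.a_eq_zero_or hp with h0 | ⟨rfl, hK⟩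
    · rw [h0, mul_zero]
    have hc := h.compat_a hp
    rw [hyp.Fexpr_eq hp]
    linear_combination (norm := (field_simp; simp only [h2, h4, h10]; ring))
      1 / (18 * v 0 p ^ 2 * (v 0 p ^ 2 + v 2 p ^ 2) ^ 5) * hc
        - 8 * v 0 p ^ 2 * v 2 p ^ 4 / (v 0 p ^ 2 + v 2 p ^ 2) ^ 3 * al v 0 p * hK
end
end

section
/- (Lemma 2.5) Under the holonomic system hypotheses with the conformally flat constant-mean-curvature ansatz, define α1 := (1/v2) ∂v2/∂u1, α2 := (1/v3) ∂v3/∂u2, α3 := (1/v1) ∂v1/∂u3. Then for each j ∈ {1, 3} there is no nonempty open subset of U on which α2 = 0 = α_j identically. -/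
noncomputable section

/-! ### Reduction to one variable -/

lemma hasDerivAt_line {f : (Fin 3 → ℝ) → ℝ} {p : Fin 3 → ℝ} {k : Fin 3} {t : ℝ}
    (hf : DifferentiableAt ℝ f (p + t • Pi.single k 1)) :
    HasDerivAt (fun s : ℝ => f (p + s • Pi.single k 1)) (pd k f (p + t • Pi.single k 1)) t := by
  have hl : HasDerivAt (fun s : ℝ => p + s • (Pi.single k 1 : Fin 3 → ℝ)) (Pi.single k 1) t := by
    simpa using ((hasDerivAt_id t).smul_const (Pi.single k 1 : Fin 3 → ℝ)).const_add p
  exact hf.hasFDerivAt.comp_hasDerivAt t hl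

lemma isOpen_line_preimage {W : Set (Fin 3 → ℝ)} (hW : IsOpen W) (p : Fin 3 → ℝ) (k : Fin 3) :
    IsOpen {t : ℝ | p + t • (Pi.single k 1 : Fin 3 → ℝ) ∈ W} :=
  hW.preimage (by fun_prop)

lemma pd_eq_zero_of_eqOn_zero {f : (Fin 3 → ℝ) → ℝ} {W : Set (Fin 3 → ℝ)} (hW : IsOpen W)
    (hf : ∀ p ∈ W, f p = 0) (k : Fin 3) {p : Fin 3 → ℝ} (hp : p ∈ W) : pd k f p = 0 := by
  have h : f =ᶠ[nhds p] fun _ => 0 := Filter.eventually_of_mem (hW.mem_nhds hp) hf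
  simp [pd, h.fderiv_eq]

lemma HasDerivAt.eq_of_eqOn {f g : ℝ → ℝ} {f' g' t : ℝ} {S : Set ℝ} (hf : HasDerivAt f f' t)
    (hg : HasDerivAt g g' t) (hS : IsOpen S) (ht : t ∈ S) (hfg : ∀ s ∈ S, f s = g s) : f' = g' :=
  (hf.congr_of_eventuallyEq
    (Filter.eventually_of_mem (hS.mem_nhds ht) fun s hs => (hfg s hs).symm)).unique hg

/-! ### The one-variable system -/

/-- The coframe `(a, b, d)` and the principal data `(A, B, C)` of a solution of the ansatz that
depends on the parameter of `d` only; `h₁`, `h₂` are the rotation coefficients. -/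
structure OneVar (S : Set ℝ) (a b d h₁ h₂ d' A B C : ℝ → ℝ) (c H : ℝ) : Prop where
  isOpen : IsOpen S
  a_pos : ∀ t ∈ S, 0 < a t
  b_pos : ∀ t ∈ S, 0 < b t
  d_pos : ∀ t ∈ S, 0 < d t
  sq : ∀ t ∈ S, b t ^ 2 = a t ^ 2 + d t ^ 2
  deriv_a : ∀ t ∈ S, HasDerivAt a (h₁ t * d t) t
  deriv_b : ∀ t ∈ S, HasDerivAt b (h₂ t * d t) t
  deriv_d : ∀ t ∈ S, HasDerivAt d (d' t) t
  deriv_h₁ : ∀ t ∈ S, HasDerivAt h₁ (-(A t * C t + c * a t * d t)) t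
  deriv_h₂ : ∀ t ∈ S, HasDerivAt h₂ (-(B t * C t + c * b t * d t)) t
  gauss : ∀ t ∈ S, h₁ t * h₂ t + A t * B t + c * a t * b t = 0
  deriv_A : ∀ t ∈ S, HasDerivAt A (h₁ t * C t) t
  A_eq : ∀ t ∈ S, A t = -(1/3) * (b t / d t + d t / b t) + (a t / 3) * H
  B_eq : ∀ t ∈ S, B t = -(1/3) * (a t / d t - d t / a t) + (b t / 3) * H
  C_eq : ∀ t ∈ S, C t = (1/3) * (a t / b t + b t / a t) + (d t / 3) * H

namespace OneVar

variable {S : Set ℝ} {a b d h₁ h₂ d' A B C : ℝ → ℝ} {c H : ℝ}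

lemma d'_eq (h : OneVar S a b d h₁ h₂ d' A B C c H) {t : ℝ} (ht : t ∈ S) :
    d' t = b t * h₂ t - a t * h₁ t := by
  have e := ((h.deriv_b t ht).pow 2).eq_of_eqOn
    (((h.deriv_a t ht).pow 2).add ((h.deriv_d t ht).pow 2)) h.isOpen ht h.sq
  have := (h.d_pos t ht).ne'
  apply mul_left_cancel₀ this
  norm_num at e
  linear_combination -(1 / 2) * e

lemma rotation_relation (h : OneVar S a b d h₁ h₂ d' A B C c H) {t : ℝ} (ht : t ∈ S) :
    h₁ t * b t ^ 5 = h₂ t * a t ^ 5 := by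
  have ha := (h.a_pos t ht).ne'
  have hb := (h.b_pos t ht).ne'
  have hd := (h.d_pos t ht).ne'
  have hs := h.sq t ht
  have e := (h.deriv_A t ht).eq_of_eqOn
    (((((h.deriv_b t ht).div (h.deriv_d t ht) hd).add
      ((h.deriv_d t ht).div (h.deriv_b t ht) hb)).const_mul (-(1/3))).add
      (((h.deriv_a t ht).div_const 3).mul_const H)) h.isOpen ht h.A_eq
  rw [h.d'_eq ht, h.C_eq t ht] at e
  generalize a t = a at *
  generalize b t = b at *
  generalize d t = d at *
  generalize h₁ t = h₁ at *
  generalize h₂ t = h₂ at *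
  field_simp at e
  grind

lemma codazzi_relation (h : OneVar S a b d h₁ h₂ d' A B C c H) {t : ℝ} (ht : t ∈ S) :
    -(A t * C t + c * a t * d t) * b t ^ 5 + (B t * C t + c * b t * d t) * a t ^ 5
      - 5 * d t * (b t ^ 4 - a t ^ 4) * (A t * B t + c * a t * b t) = 0 := by
  have e := ((h.deriv_h₁ t ht).mul ((h.deriv_b t ht).pow 5)).eq_of_eqOn
    ((h.deriv_h₂ t ht).mul ((h.deriv_a t ht).pow 5)) h.isOpen ht fun s hs => h.rotation_relation hs
  norm_num at e
  linear_combination e - 5 * d t * (b t ^ 4 - a t ^ 4) * h.gauss t ht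

lemma algebraic_relation (h : OneVar S a b d h₁ h₂ d' A B C c H) {t : ℝ} (ht : t ∈ S) :
    (2 * (H ^ 2 + 9 * c) * (a t * b t / d t) ^ 2 - 4) * (1 - ((a t / b t) ^ 2) ^ 2)
      - (a t * b t / d t) * H * (2 * ((a t / b t) ^ 2) ^ 2 + 3 * (a t / b t) ^ 2 + 2) = 0 := by
  have ha := (h.a_pos t ht).ne'
  have hb := (h.b_pos t ht).ne'
  have hd := (h.d_pos t ht).ne'
  have hs := h.sq t ht
  have e := h.codazzi_relation ht
  have eA : A t * (3 * b t * d t) = -(b t ^ 2 + d t ^ 2) + H * (a t * b t * d t) := by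
    rw [h.A_eq t ht]; field_simp
  have eB : B t * (3 * a t * d t) = -(a t ^ 2 - d t ^ 2) + H * (a t * b t * d t) := by
    rw [h.B_eq t ht]; field_simp
  have eC : C t * (3 * a t * b t) = a t ^ 2 + b t ^ 2 + H * (a t * b t * d t) := by
    rw [h.C_eq t ht]; field_simp
  generalize a t = a at *
  generalize b t = b at *
  generalize d t = d at *
  generalize A t = A at *
  generalize B t = B at *
  generalize C t = C at *
  set w := a * b * d with hw
  have e₁ : -((-(b ^ 2 + d ^ 2) + H * w) * (a ^ 2 + b ^ 2 + H * w) + 9 * c * w ^ 2) * b ^ 4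
      + ((-(a ^ 2 - d ^ 2) + H * w) * (a ^ 2 + b ^ 2 + H * w) + 9 * c * w ^ 2) * a ^ 4
      - 5 * (b ^ 4 - a ^ 4) *
        ((-(b ^ 2 + d ^ 2) + H * w) * (-(a ^ 2 - d ^ 2) + H * w) + 9 * c * w ^ 2) = 0 := by
    rw [← eA, ← eB, ← eC, hw]
    linear_combination 9 * a * b * d * e
  have hw₂ : w ^ 2 = a ^ 2 * (a ^ 2 + d ^ 2) * d ^ 2 := by rw [hw, ← hs]; ring
  have e₂ : (2 * (H ^ 2 + 9 * c) * w ^ 2 - 4 * d ^ 4) * (b ^ 4 - a ^ 4)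
      - w * H * d ^ 2 * (2 * a ^ 4 + 3 * a ^ 2 * b ^ 2 + 2 * b ^ 4) = 0 := by
    have hb₄ : b ^ 4 = (a ^ 2 + d ^ 2) ^ 2 := by rw [← hs]; ring
    rw [hb₄, hs] at e₁ ⊢
    linear_combination -(1 / 3) * e₁
  have e₃ : a * b / d = w / d ^ 2 := by rw [hw]; field_simp
  rw [e₃]
  clear_value w
  field_simp
  linear_combination e₂

/-- With `y = (a / b)²` and `q = a b / d`, one has `y' = 2 (1 - y²) m` and `q' = q m` for the same
factor `m`, so polynomial relations between `y` and `q` can be differentiated formally. -/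
lemma hasDerivAt_relation_variables (h : OneVar S a b d h₁ h₂ d' A B C c H) {t : ℝ} (ht : t ∈ S) :
    HasDerivAt (fun s => (a s / b s) ^ 2)
      (2 * (1 - ((a t / b t) ^ 2) ^ 2) * -(h₂ t * a t ^ 2 * d t / b t ^ 3)) t ∧
    HasDerivAt (fun s => a s * b s / d s)
      (a t * b t / d t * -(h₂ t * a t ^ 2 * d t / b t ^ 3)) t := by
  have ha := (h.a_pos t ht).ne'
  have hb := (h.b_pos t ht).ne'
  have hd := (h.d_pos t ht).ne'
  have hs := h.sq t ht
  have e : h₁ t = h₂ t * a t ^ 5 / b t ^ 5 := by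
    rw [eq_div_iff (by positivity)]; exact h.rotation_relation ht
  constructor
  · refine (((h.deriv_a t ht).div (h.deriv_b t ht) hb).pow 2).congr_deriv ?_
    rw [e]
    simp only [Pi.div_apply]
    generalize a t = a at *
    generalize b t = b at *
    generalize d t = d at *
    field_simp
    grind
  · refine (((h.deriv_a t ht).mul (h.deriv_b t ht)).div (h.deriv_d t ht) hd).congr_deriv ?_
    rw [h.d'_eq ht, e]
    simp only [Pi.mul_apply]
    generalize a t = a at *
    generalize b t = b at *
    generalize d t = d at *
    field_simp
    grind

/-- Differentiating `algebraic_relation` twice gives three equations linear in `(K q², q H, 1)`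
whose determinant `60 (2 y² + 3 y + 2)` is positive. -/
lemma h₂_eq_zero (h : OneVar S a b d h₁ h₂ d' A B C c H) {t : ℝ} (ht : t ∈ S) : h₂ t = 0 := by
  by_contra hne
  have hS' : IsOpen (S ∩ h₂ ⁻¹' {0}ᶜ) :=
    ContinuousOn.isOpen_inter_preimage
      (fun s hs => (h.deriv_h₂ s hs).continuousAt.continuousWithinAt) h.isOpen isOpen_compl_singleton
  set y : ℝ → ℝ := fun s => (a s / b s) ^ 2 with hy
  set q : ℝ → ℝ := fun s => a s * b s / d s with hq
  set K := H ^ 2 + 9 * c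
  have key : ∀ s ∈ S ∩ h₂ ⁻¹' {0}ᶜ, 0 < y s ∧ y s < 1 ∧ ∃ m : ℝ, m ≠ 0 ∧
      HasDerivAt y (2 * (1 - y s ^ 2) * m) s ∧ HasDerivAt q (q s * m) s := by
    rintro s ⟨hs, hs'⟩
    have ha := h.a_pos s hs
    have hb := h.b_pos s hs
    have hd := h.d_pos s hs
    have hsq := h.sq s hs
    obtain ⟨hdy, hdq⟩ := h.hasDerivAt_relation_variables hs
    refine ⟨by positivity, ?_, -(h₂ s * a s ^ 2 * d s / b s ^ 3), ?_, hdy, hdq⟩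
    · rw [hy]
      simp only [div_pow]
      rw [div_lt_one (by positivity)]
      nlinarith
    · have : h₂ s ≠ 0 := hs'
      simp [this, ha.ne', hb.ne', hd.ne']
  have e₀ : ∀ s ∈ S ∩ h₂ ⁻¹' {0}ᶜ, (2 * K * q s ^ 2 - 4) * (1 - y s ^ 2)
      - q s * H * (2 * y s ^ 2 + 3 * y s + 2) = 0 := fun s hs => h.algebraic_relation hs.1
  have e₁ : ∀ s ∈ S ∩ h₂ ⁻¹' {0}ᶜ, K * q s ^ 2 * (1 - 4 * y s) - q s * H * (4 * y s + 3)
      + 2 * (1 + 4 * y s) = 0 := by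
    intro s hs
    obtain ⟨hy₀, hy₁, m, hm, hdy, hdq⟩ := key s hs
    have e := HasDerivAt.eq_of_eqOn
      (((((hdq.pow 2).const_mul (2 * K)).sub_const 4).mul ((hdy.pow 2).const_sub 1)).sub
        ((hdq.mul_const H).mul ((((hdy.pow 2).const_mul 2).add (hdy.const_mul 3)).add_const 2)))
      (hasDerivAt_const s (0 : ℝ)) hS' hs e₀
    have hne : 2 * (1 - y s ^ 2) * m ≠ 0 := mul_ne_zero (by nlinarith) hm
    apply mul_left_cancel₀ hne
    norm_num at e
    linear_combination e - m * e₀ s hs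
  have e₂ : K * q t ^ 2 * (8 * y t ^ 2 - 8 * y t - 6) - q t * H * (-8 * y t ^ 2 + 4 * y t + 11)
      + 16 * (1 - y t ^ 2) = 0 := by
    obtain ⟨hy₀, hy₁, m, hm, hdy, hdq⟩ := key t ⟨ht, hne⟩
    have e := HasDerivAt.eq_of_eqOn
      (((((hdq.pow 2).const_mul K).mul ((hdy.const_mul 4).const_sub 1)).sub
        ((hdq.mul_const H).mul ((hdy.const_mul 4).add_const 3))).add
        (((hdy.const_mul 4).const_add 1).const_mul 2))
      (hasDerivAt_const t (0 : ℝ)) hS' ⟨ht, hne⟩ e₁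
    apply mul_left_cancel₀ hm
    norm_num at e
    linear_combination e
  obtain ⟨hy₀, hy₁, -⟩ := key t ⟨ht, hne⟩
  have e₀' := e₀ t ⟨ht, hne⟩
  have e₁' := e₁ t ⟨ht, hne⟩
  have hdet : 60 * (2 * y t ^ 2 + 3 * y t + 2) = 0 := by
    linear_combination
      ((1 - 4 * y t) * (8 * y t ^ 2 - 4 * y t - 11)
        + (4 * y t + 3) * (8 * y t ^ 2 - 8 * y t - 6)) * e₀'
      - (2 * (1 - y t ^ 2) * (8 * y t ^ 2 - 4 * y t - 11)
        + (2 * y t ^ 2 + 3 * y t + 2) * (8 * y t ^ 2 - 8 * y t - 6)) * e₁'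
      + (-2 * (1 - y t ^ 2) * (4 * y t + 3) + (2 * y t ^ 2 + 3 * y t + 2) * (1 - 4 * y t)) * e₂
  nlinarith

lemma notMem (h : OneVar S a b d h₁ h₂ d' A B C c H) (t : ℝ) : t ∉ S := by
  intro ht
  have ha := (h.a_pos t ht)
  have hb := (h.b_pos t ht)
  have hd := (h.d_pos t ht)
  have hs := h.sq t ht
  have h₂₀ : ∀ s ∈ S, h₂ s = 0 := fun s hs => h.h₂_eq_zero hs
  have h₁₀ : ∀ s ∈ S, h₁ s = 0 := by
    intro s hs
    have e := h.rotation_relation hs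
    rw [h₂₀ s hs, zero_mul] at e
    exact (mul_eq_zero.1 e).resolve_right (pow_ne_zero _ (h.b_pos s hs).ne')
  have eAC := (h.deriv_h₁ t ht).eq_of_eqOn (hasDerivAt_const t (0 : ℝ)) h.isOpen ht h₁₀
  have eBC := (h.deriv_h₂ t ht).eq_of_eqOn (hasDerivAt_const t (0 : ℝ)) h.isOpen ht h₂₀
  have eAB := h.gauss t ht
  rw [h₂₀ t ht, mul_zero, zero_add] at eAB
  have eA := h.A_eq t ht
  have eB := h.B_eq t ht
  have eC := h.C_eq t ht
  generalize a t = a at *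
  generalize b t = b at *
  generalize d t = d at *
  generalize A t = A at *
  generalize B t = B at *
  generalize C t = C at *
  have horth : A * a - B * b + C * d = 0 := by
    rw [eA, eB, eC]
    field_simp
    linear_combination -(b * d * a * H) * hs
  have hnorm : A ^ 2 - B ^ 2 + C ^ 2 = 1 := by
    rw [eA, eB, eC]
    clear eA eB eC eAB eBC eAC horth h h₁₀ h₂₀
    field_simp
    grind
  have hA : A ^ 2 = -c * a ^ 2 := by
    apply mul_left_cancel₀ ha.ne'
    linear_combination A * horth + b * eAB + d * eAC - c * a * hs
  have hB : B ^ 2 = -c * b ^ 2 := by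
    apply mul_left_cancel₀ hb.ne'
    linear_combination -B * horth + a * eAB - d * eBC + c * b * hs
  have hC : C ^ 2 = -c * d ^ 2 := by
    apply mul_left_cancel₀ hd.ne'
    linear_combination C * horth + a * eAC - b * eBC - c * d * hs
  rw [hA, hB, hC] at hnorm
  have : (0 : ℝ) = 1 := by linear_combination hnorm - c * hs
  norm_num at this

end OneVar

/-! ### Vanishing of the remaining derivatives -/

namespace Hypo

variable {U : Set (Fin 3 → ℝ)} {v V : Fin 3 → (Fin 3 → ℝ) → ℝ} {c H : ℝ}

lemma contDiffAt_v (h : Hypo U v V c H) (i : Fin 3) {p : Fin 3 → ℝ} (hp : p ∈ U) :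
    ContDiffAt ℝ (⊤ : ℕ∞) (v i) p :=
  (h.smooth_v i).contDiffAt (h.hopen.mem_nhds hp)

lemma differentiableAt_v (h : Hypo U v V c H) (i : Fin 3) {p : Fin 3 → ℝ} (hp : p ∈ U) :
    DifferentiableAt ℝ (v i) p :=
  (h.contDiffAt_v i hp).differentiableAt (by simp)

lemma differentiableAt_V (h : Hypo U v V c H) (i : Fin 3) {p : Fin 3 → ℝ} (hp : p ∈ U) :
    DifferentiableAt ℝ (V i) p :=
  ((h.smooth_V i).contDiffAt (h.hopen.mem_nhds hp)).differentiableAt (by simp)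

lemma differentiableAt_hh (h : Hypo U v V c H) (i j : Fin 3) {p : Fin 3 → ℝ} (hp : p ∈ U) :
    DifferentiableAt ℝ (hh v i j) p := by
  have h₁ : DifferentiableAt ℝ (fderiv ℝ (v j)) p :=
    ((h.contDiffAt_v j hp).fderiv_right (m := 1) (by norm_cast)).differentiableAt (by simp)
  have h₂ := (h.pos i p hp).ne'
  have h₃ := h.differentiableAt_v i hp
  unfold hh pd
  fun_prop (disch := assumption)

lemma v_mul_pd (h : Hypo U v V c H) (k : Fin 3) {p : Fin 3 → ℝ} (hp : p ∈ U) :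
    v 1 p * pd k (v 1) p = v 0 p * pd k (v 0) p + v 2 p * pd k (v 2) p := by
  have hS := isOpen_line_preimage h.hopen p k
  have h₀ : (0 : ℝ) ∈ {t : ℝ | p + t • (Pi.single k 1 : Fin 3 → ℝ) ∈ U} := by simpa using hp
  have hv (i) := hasDerivAt_line (h.differentiableAt_v i h₀)
  have e := ((hv 1).pow 2).eq_of_eqOn (((hv 0).pow 2).add ((hv 2).pow 2)) hS h₀
    fun s hs => h.ansatz_v _ hs
  norm_num at e
  linear_combination (1 / 2) * e

lemma pd_V_zero (h : Hypo U v V c H) (k : Fin 3) {p : Fin 3 → ℝ} (hp : p ∈ U) :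
    pd k (V 0) p = -(1 / 3) * (v 2 p * pd k (v 1) p - v 1 p * pd k (v 2) p)
      * (1 / v 2 p ^ 2 - 1 / v 1 p ^ 2) + pd k (v 0) p / 3 * H := by
  have hS := isOpen_line_preimage h.hopen p k
  have h₀ : (0 : ℝ) ∈ {t : ℝ | p + t • (Pi.single k 1 : Fin 3 → ℝ) ∈ U} := by simpa using hp
  have hv (i) := hasDerivAt_line (h.differentiableAt_v i h₀)
  have hpos (i) : v i (p + (0 : ℝ) • (Pi.single k 1 : Fin 3 → ℝ)) ≠ 0 := (h.pos i _ h₀).ne'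
  have e := (hasDerivAt_line (h.differentiableAt_V 0 h₀)).eq_of_eqOn
    (((((hv 1).div (hv 2) (hpos 2)).add ((hv 2).div (hv 1) (hpos 1))).const_mul (-(1/3))).add
      (((hv 0).div_const 3).mul_const H)) hS h₀ fun s hs => h.ansatz_V1 _ hs
  simp only [zero_smul, add_zero] at e
  rw [e]
  ring

lemma pd_V_one (h : Hypo U v V c H) (k : Fin 3) {p : Fin 3 → ℝ} (hp : p ∈ U) :
    pd k (V 1) p = -(1 / 3) * (v 2 p * pd k (v 0) p - v 0 p * pd k (v 2) p)
      * (1 / v 2 p ^ 2 + 1 / v 0 p ^ 2) + pd k (v 1) p / 3 * H := by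
  have hS := isOpen_line_preimage h.hopen p k
  have h₀ : (0 : ℝ) ∈ {t : ℝ | p + t • (Pi.single k 1 : Fin 3 → ℝ) ∈ U} := by simpa using hp
  have hv (i) := hasDerivAt_line (h.differentiableAt_v i h₀)
  have hpos (i) : v i (p + (0 : ℝ) • (Pi.single k 1 : Fin 3 → ℝ)) ≠ 0 := (h.pos i _ h₀).ne'
  have e := (hasDerivAt_line (h.differentiableAt_V 1 h₀)).eq_of_eqOn
    (((((hv 0).div (hv 2) (hpos 2)).sub ((hv 2).div (hv 0) (hpos 0))).const_mul (-(1/3))).add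
      (((hv 1).div_const 3).mul_const H)) hS h₀ fun s hs => h.ansatz_V2 _ hs
  simp only [zero_smul, add_zero] at e
  rw [e]
  ring

lemma pd_V_two (h : Hypo U v V c H) (k : Fin 3) {p : Fin 3 → ℝ} (hp : p ∈ U) :
    pd k (V 2) p = (1 / 3) * (v 1 p * pd k (v 0) p - v 0 p * pd k (v 1) p)
      * (1 / v 1 p ^ 2 - 1 / v 0 p ^ 2) + pd k (v 2) p / 3 * H := by
  have hS := isOpen_line_preimage h.hopen p k
  have h₀ : (0 : ℝ) ∈ {t : ℝ | p + t • (Pi.single k 1 : Fin 3 → ℝ) ∈ U} := by simpa using hp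
  have hv (i) := hasDerivAt_line (h.differentiableAt_v i h₀)
  have hpos (i) : v i (p + (0 : ℝ) • (Pi.single k 1 : Fin 3 → ℝ)) ≠ 0 := (h.pos i _ h₀).ne'
  have e := (hasDerivAt_line (h.differentiableAt_V 2 h₀)).eq_of_eqOn
    (((((hv 0).div (hv 1) (hpos 1)).add ((hv 1).div (hv 0) (hpos 0))).const_mul (1/3)).add
      (((hv 2).div_const 3).mul_const H)) hS h₀ fun s hs => h.ansatz_V3 _ hs
  simp only [zero_smul, add_zero] at e
  rw [e]
  ring

lemma pd_zero_eq_zero (h : Hypo U v V c H) {p : Fin 3 → ℝ} (hp : p ∈ U) (hα : al v 0 p = 0)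
    (j : Fin 3) : pd 0 (v j) p = 0 := by
  have ha := h.pos 0 p hp
  have hb := h.pos 1 p hp
  have hd := h.pos 2 p hp
  have h₁ : pd 0 (v 1) p = 0 := by simpa [al, hb.ne'] using hα
  have hs := h.v_mul_pd 0 hp
  have e := h.holiv 1 0 (by decide) p hp
  rw [h.pd_V_one 0 hp, hh, h₁] at e
  have e' : v 2 p * pd 0 (v 0) p - v 0 p * pd 0 (v 2) p = 0 := by
    have : (v 2 p ^ 2)⁻¹ + (v 0 p ^ 2)⁻¹ ≠ 0 := by positivity
    simpa [this] using e
  rw [h₁, mul_zero] at hs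
  have h₀ : pd 0 (v 0) p = 0 := by
    have : v 0 p ^ 2 + v 2 p ^ 2 ≠ 0 := by positivity
    apply mul_left_cancel₀ this
    linear_combination -v 0 p * hs + v 2 p * e'
  have h₂ : pd 0 (v 2) p = 0 := by simpa [h₀, hd.ne'] using hs
  fin_cases j <;> assumption

lemma pd_one_eq_zero (h : Hypo U v V c H) {p : Fin 3 → ℝ} (hp : p ∈ U) (hα : al v 1 p = 0)
    (j : Fin 3) : pd 1 (v j) p = 0 := by
  have ha := h.pos 0 p hp
  have hb := h.pos 1 p hp
  have hd := h.pos 2 p hp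
  have h₂ : pd 1 (v 2) p = 0 := by simpa [al, hd.ne'] using hα
  have hs := h.v_mul_pd 1 hp
  have hv := h.ansatz_v p hp
  have e := h.holiv 2 1 (by decide) p hp
  rw [h.pd_V_two 1 hp, hh, h₂] at e
  have e' : v 1 p * pd 1 (v 0) p - v 0 p * pd 1 (v 1) p = 0 := by
    have : (v 1 p ^ 2)⁻¹ - (v 0 p ^ 2)⁻¹ ≠ 0 := by
      have hlt : v 0 p ^ 2 < v 1 p ^ 2 := by rw [hv]; linarith [pow_pos hd 2]
      exact (sub_neg.2 (inv_strictAnti₀ (pow_pos ha 2) hlt)).ne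
    simpa [this] using e
  rw [h₂, mul_zero, add_zero] at hs
  have h₀ : pd 1 (v 0) p = 0 := by
    have : v 2 p ^ 2 ≠ 0 := by positivity
    apply mul_left_cancel₀ this
    linear_combination v 0 p * hs + v 1 p * e' - pd 1 (v 0) p * hv
  have h₁ : pd 1 (v 1) p = 0 := by simpa [h₀, hb.ne'] using hs
  fin_cases j <;> assumption

lemma pd_two_eq_zero (h : Hypo U v V c H) {p : Fin 3 → ℝ} (hp : p ∈ U) (hα : al v 2 p = 0)
    (j : Fin 3) : pd 2 (v j) p = 0 := by
  have ha := h.pos 0 p hp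
  have hb := h.pos 1 p hp
  have hd := h.pos 2 p hp
  have h₀ : pd 2 (v 0) p = 0 := by simpa [al, ha.ne'] using hα
  have hs := h.v_mul_pd 2 hp
  have hv := h.ansatz_v p hp
  have e := h.holiv 0 2 (by decide) p hp
  rw [h.pd_V_zero 2 hp, hh, h₀] at e
  have e' : v 2 p * pd 2 (v 1) p - v 1 p * pd 2 (v 2) p = 0 := by
    have : (v 2 p ^ 2)⁻¹ - (v 1 p ^ 2)⁻¹ ≠ 0 := by
      have hlt : v 2 p ^ 2 < v 1 p ^ 2 := by rw [hv]; linarith [pow_pos ha 2]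
      exact (sub_pos.2 (inv_strictAnti₀ (pow_pos hd 2) hlt)).ne'
    simpa [this] using e
  rw [h₀, mul_zero, zero_add] at hs
  have h₁ : pd 2 (v 1) p = 0 := by
    have : v 0 p ^ 2 ≠ 0 := by positivity
    apply mul_left_cancel₀ this
    linear_combination v 1 p * hs - v 2 p * e' - pd 2 (v 1) p * hv
  have h₂ : pd 2 (v 2) p = 0 := by simpa [h₁, hd.ne'] using hs
  fin_cases j <;> assumption

/-- No solution depends on the single coordinate `u_{k+1}` on a nonempty open set. The sign `ε`
accounts for the symmetry of the ansatz exchanging the first and third coordinates. -/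
lemma notMem_of_pd_eq_zero (h : Hypo U v V c H) {i k : Fin 3} (hi : i ≠ 1) (hk : k ≠ 1)
    (hik : i ≠ k) {W : Set (Fin 3 → ℝ)} (hW : IsOpen W) (hWU : W ⊆ U)
    (hpi : ∀ p ∈ W, ∀ j, pd i (v j) p = 0) (hp₁ : ∀ p ∈ W, ∀ j, pd 1 (v j) p = 0)
    (ε : ℝ) (hε : ε ^ 2 = 1)
    (hA : ∀ p ∈ W, ε * V i p
      = -(1/3) * (v 1 p / v k p + v k p / v 1 p) + (v i p / 3) * (ε * H))
    (hB : ∀ p ∈ W, ε * V 1 p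
      = -(1/3) * (v i p / v k p - v k p / v i p) + (v 1 p / 3) * (ε * H))
    (hC : ∀ p ∈ W, ε * V k p
      = (1/3) * (v i p / v 1 p + v 1 p / v i p) + (v k p / 3) * (ε * H))
    (hsq : ∀ p ∈ W, v 1 p ^ 2 = v i p ^ 2 + v k p ^ 2) (p : Fin 3 → ℝ) : p ∉ W := by
  intro hp
  have hhi : ∀ j, ∀ p ∈ W, hh v i j p = 0 := fun j p hp => by simp [hh, hpi p hp j]
  have hh₁ : ∀ j, ∀ p ∈ W, hh v 1 j p = 0 := fun j p hp => by simp [hh, hp₁ p hp j]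
  have gauss_i : ∀ p ∈ W, pd k (hh v k i) p = -(V i p * V k p + c * v i p * v k p) := by
    intro p hp
    have e := h.holiii i k 1 hik hk hi p (hWU hp)
    rw [pd_eq_zero_of_eqOn_zero hW (hhi k) i hp, hh₁ i p hp] at e
    linear_combination e
  have gauss_one : ∀ p ∈ W, pd k (hh v k 1) p = -(V 1 p * V k p + c * v 1 p * v k p) := by
    intro p hp
    have e := h.holiii 1 k i hk.symm hik.symm hi.symm p (hWU hp)
    rw [pd_eq_zero_of_eqOn_zero hW (hh₁ k) 1 hp, hhi 1 p hp] at e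
    linear_combination e
  have gauss_k : ∀ p ∈ W, hh v k i p * hh v k 1 p + V i p * V 1 p + c * v i p * v 1 p = 0 := by
    intro p hp
    have e := h.holiii i 1 k hi hk.symm hik p (hWU hp)
    rw [pd_eq_zero_of_eqOn_zero hW (hhi 1) i hp, pd_eq_zero_of_eqOn_zero hW (hh₁ i) 1 hp] at e
    linear_combination e
  let l : ℝ → Fin 3 → ℝ := fun t => p + t • Pi.single k 1
  have hv (j : Fin 3) {t : ℝ} (ht : l t ∈ W) : HasDerivAt (fun t => v j (l t)) (pd k (v j) (l t)) t :=
    hasDerivAt_line (h.differentiableAt_v j (hWU ht))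
  have hhd (j : Fin 3) {t : ℝ} (ht : l t ∈ W) :
      HasDerivAt (fun t => hh v k j (l t)) (pd k (hh v k j) (l t)) t :=
    hasDerivAt_line (h.differentiableAt_hh k j (hWU ht))
  have sol : OneVar {t | l t ∈ W} (fun t => v i (l t)) (fun t => v 1 (l t)) (fun t => v k (l t))
      (fun t => hh v k i (l t)) (fun t => hh v k 1 (l t)) (fun t => pd k (v k) (l t))
      (fun t => ε * V i (l t)) (fun t => ε * V 1 (l t)) (fun t => ε * V k (l t)) c (ε * H) :=
    { isOpen := isOpen_line_preimage hW p k
      a_pos := fun t ht => h.pos i _ (hWU ht)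
      b_pos := fun t ht => h.pos 1 _ (hWU ht)
      d_pos := fun t ht => h.pos k _ (hWU ht)
      sq := fun t ht => hsq _ ht
      deriv_a := fun t ht => (hv i ht).congr_deriv (h.holi i k hik _ (hWU ht))
      deriv_b := fun t ht => (hv 1 ht).congr_deriv (h.holi 1 k hk.symm _ (hWU ht))
      deriv_d := fun t ht => hv k ht
      deriv_h₁ := fun t ht => (hhd i ht).congr_deriv <| by
        rw [gauss_i _ ht]; linear_combination V i (l t) * V k (l t) * hε
      deriv_h₂ := fun t ht => (hhd 1 ht).congr_deriv <| by
        rw [gauss_one _ ht]; linear_combination V 1 (l t) * V k (l t) * hε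
      gauss := fun t ht => by
        linear_combination gauss_k _ ht + V i (l t) * V 1 (l t) * hε
      deriv_A := fun t ht =>
        ((hasDerivAt_line (h.differentiableAt_V i (hWU ht))).const_mul ε).congr_deriv <| by
          rw [h.holiv i k hik _ (hWU ht)]; ring
      A_eq := fun t ht => hA _ ht
      B_eq := fun t ht => hB _ ht
      C_eq := fun t ht => hC _ ht }
  exact sol.notMem 0 (by simpa [l] using hp)

end Hypo

theorem statement_7 (U : Set (Fin 3 → ℝ)) (v V : Fin 3 → (Fin 3 → ℝ) → ℝ) (c H : ℝ)
    (hyp : Hypo U v V c H) : ∀ j : Fin 3, j = 0 ∨ j = 2 →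
    ∀ W : Set (Fin 3 → ℝ), IsOpen W → W ⊆ U → W.Nonempty →
    ¬ (∀ p ∈ W, al v 1 p = 0 ∧ al v j p = 0) := by
  rintro j hj W hW hWU ⟨p, hp⟩ hα
  have hp₁ : ∀ q ∈ W, ∀ l, pd 1 (v l) q = 0 := fun q hq => hyp.pd_one_eq_zero (hWU hq) (hα q hq).1
  rcases hj with rfl | rfl
  · refine hyp.notMem_of_pd_eq_zero (i := 0) (k := 2) (by decide) (by decide) (by decide) hW hWU
      (fun q hq => hyp.pd_zero_eq_zero (hWU hq) (hα q hq).2) hp₁ 1 (by norm_num)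
      (fun q hq => ?_) (fun q hq => ?_) (fun q hq => ?_) (fun q hq => hyp.ansatz_v q (hWU hq)) p hp
    · rw [hyp.ansatz_V1 q (hWU hq)]; ring
    · rw [hyp.ansatz_V2 q (hWU hq)]; ring
    · rw [hyp.ansatz_V3 q (hWU hq)]; ring
  · refine hyp.notMem_of_pd_eq_zero (i := 2) (k := 0) (by decide) (by decide) (by decide) hW hWU
      (fun q hq => hyp.pd_two_eq_zero (hWU hq) (hα q hq).2) hp₁ (-1) (by norm_num)
      (fun q hq => ?_) (fun q hq => ?_) (fun q hq => ?_)
      (fun q hq => by rw [hyp.ansatz_v q (hWU hq), add_comm]) p hp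
    · rw [hyp.ansatz_V3 q (hWU hq)]; ring
    · rw [hyp.ansatz_V2 q (hWU hq)]; ring
    · rw [hyp.ansatz_V1 q (hWU hq)]; ring
end
end
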